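/- arXiv:1603.02890 — 2 statements merged into one kernel-verified Lean document; each statement's English description precedes it below -/
import Mathlib

section
/- There is an absolute constant C such that for every odd prime power q and every positive integer n, |B(n,q) − K_q · binom(n−1/2, n) · qⁿ| ≤ C · q^{n−1} / n^{3/2}. In particular B(n,q) ~ K_q · binom(n−1/2, n) · qⁿ as qⁿ → ∞. -/
/-- Generalized binomial coefficient `binom(x, n) = x(x-1)⋯(x-n+1)/n!` for real `x`. -/
noncomputable def rbinom (x : ℝ) (n : ℕ) : ℝ :=
  (∏ i ∈ Finset.range n, (x - (i : ℝ))) / (Nat.factorial n : ℝ)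

/-! ### Logarithmic derivatives of power series -/

/-- `L` is the logarithmic derivative of `f` with respect to `X · d/dX`. -/
def HasLogDeriv (f L : PowerSeries ℝ) : Prop :=
  PowerSeries.X * PowerSeries.derivative ℝ f = L * f

lemma coeff_X_mul_derivative (f : PowerSeries ℝ) (n : ℕ) :
    PowerSeries.coeff n (PowerSeries.X * PowerSeries.derivative ℝ f) =
      n * PowerSeries.coeff n f := by
  cases n with
  | zero => simp
  | succ n =>
    rw [PowerSeries.coeff_succ_X_mul, PowerSeries.coeff_derivative]
    push_cast
    ring

lemma hasLogDeriv_iff (f L : PowerSeries ℝ) :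
    HasLogDeriv f L ↔ ∀ n : ℕ, n * PowerSeries.coeff n f =
      ∑ p ∈ Finset.HasAntidiagonal.antidiagonal n,
        PowerSeries.coeff p.1 L * PowerSeries.coeff p.2 f := by
  unfold HasLogDeriv
  rw [PowerSeries.ext_iff]
  simp only [coeff_X_mul_derivative]
  simp only [PowerSeries.coeff_mul]

lemma HasLogDeriv.mul {f g L M : PowerSeries ℝ} (hf : HasLogDeriv f L) (hg : HasLogDeriv g M) :
    HasLogDeriv (f * g) (L + M) := by
  unfold HasLogDeriv at *
  rw [Derivation.leibniz, smul_eq_mul, smul_eq_mul]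
  linear_combination f * hg + g * hf

lemma HasLogDeriv.of_mul_right {f g L M : PowerSeries ℝ} (hfg : HasLogDeriv (f * g) L)
    (hg : HasLogDeriv g M) (h0 : g ≠ 0) : HasLogDeriv f (L - M) := by
  unfold HasLogDeriv at *
  rw [Derivation.leibniz, smul_eq_mul, smul_eq_mul] at hfg
  apply mul_right_cancel₀ h0
  linear_combination hfg - f * hg

/-- A comparison principle for power series with nonnegative logarithmic derivatives. -/
lemma HasLogDeriv.coeff_le {f g L M : PowerSeries ℝ} (hf : HasLogDeriv f L)
    (hg : HasLogDeriv g M) (hL : ∀ n, 0 ≤ PowerSeries.coeff n L)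
    (hLM : ∀ n, PowerSeries.coeff n L ≤ PowerSeries.coeff n M)
    (hM : PowerSeries.coeff 0 M = 0)
    (hf0 : 0 ≤ PowerSeries.coeff 0 f) (h0 : PowerSeries.coeff 0 f ≤ PowerSeries.coeff 0 g)
    (n : ℕ) : 0 ≤ PowerSeries.coeff n f ∧ PowerSeries.coeff n f ≤ PowerSeries.coeff n g := by
  rw [hasLogDeriv_iff] at hf hg
  induction n using Nat.strong_induction_on with
  | _ n ih =>
    rcases Nat.eq_zero_or_pos n with rfl | hn
    · exact ⟨hf0, h0⟩
    have hL0 : PowerSeries.coeff 0 L = 0 := le_antisymm (hM ▸ hLM 0) (hL 0)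
    have hn' : (0 : ℝ) < n := by exact_mod_cast hn
    have key : ∀ p ∈ Finset.HasAntidiagonal.antidiagonal n,
        0 ≤ PowerSeries.coeff p.1 L * PowerSeries.coeff p.2 f ∧
        PowerSeries.coeff p.1 L * PowerSeries.coeff p.2 f ≤
          PowerSeries.coeff p.1 M * PowerSeries.coeff p.2 g := by
      rintro ⟨i, j⟩ hp
      rw [Finset.HasAntidiagonal.mem_antidiagonal] at hp
      rcases Nat.eq_zero_or_pos i with rfl | hi
      · simp [hL0, hM]
      · have := ih j (by simp at hp; omega)
        exact ⟨mul_nonneg (hL i) this.1,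
          mul_le_mul (hLM i) this.2 this.1 ((hL i).trans (hLM i))⟩
    have h1 := Finset.sum_nonneg fun p hp => (key p hp).1
    have h2 := Finset.sum_le_sum fun p hp => (key p hp).2
    rw [← hf n] at h1 h2
    rw [← hg n] at h2
    exact ⟨nonneg_of_mul_nonneg_right h1 hn', le_of_mul_le_mul_left h2 hn'⟩

/-- If the logarithmic derivative of `f` vanishes in degrees `≤ N`, then so does `f` in degrees
`1, …, N`. -/
lemma HasLogDeriv.coeff_eq_zero {f L : PowerSeries ℝ} (hf : HasLogDeriv f L) {N : ℕ}
    (hL : ∀ n ≤ N, PowerSeries.coeff n L = 0) {n : ℕ} (hn : 0 < n) (hnN : n ≤ N) :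
    PowerSeries.coeff n f = 0 := by
  rw [hasLogDeriv_iff] at hf
  have := hf n
  rw [Finset.sum_eq_zero] at this
  · rcases mul_eq_zero.1 this with h | h
    · exact absurd h (by exact_mod_cast hn.ne')
    · exact h
  · rintro ⟨i, j⟩ hp
    rw [Finset.HasAntidiagonal.mem_antidiagonal] at hp
    rw [hL i (by simp at hp; omega), zero_mul]

/-- The logarithmic derivative of a nonzero power series is unique. -/
lemma HasLogDeriv.logDeriv_eq {f L M : PowerSeries ℝ} (hL : HasLogDeriv f L)
    (hM : HasLogDeriv f M) (h0 : f ≠ 0) : L = M :=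
  mul_right_cancel₀ h0 (hL.symm.trans hM)

/-- The series `∑_{j ≥ 1} w X^{w j}`. -/
noncomputable def geomLogDeriv (w : ℕ) : PowerSeries ℝ :=
  PowerSeries.mk fun j => if 0 < j ∧ w ∣ j then (w : ℝ) else 0

lemma hasLogDeriv_one_sub_X_pow {w : ℕ} (hw : 0 < w) :
    HasLogDeriv (1 - PowerSeries.X ^ w) (-geomLogDeriv w) := by
  unfold HasLogDeriv
  ext n
  have hc : ∀ j, PowerSeries.coeff j (geomLogDeriv w) = if 0 < j ∧ w ∣ j then (w : ℝ) else 0 :=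
    fun j => PowerSeries.coeff_mk _ _
  rw [coeff_X_mul_derivative, neg_mul, mul_sub, mul_one, map_neg, map_sub, map_sub,
    PowerSeries.coeff_mul_X_pow', PowerSeries.coeff_X_pow, PowerSeries.coeff_one, hc, hc]
  rcases lt_trichotomy n w with h | rfl | h
  · have h1 : ¬(0 < n ∧ w ∣ n) := fun h1 => absurd (Nat.le_of_dvd h1.1 h1.2) (by omega)
    rw [if_neg h1, if_neg h.ne, if_neg (by omega : ¬ w ≤ n)]
    by_cases hn : n = 0 <;> simp [hn]
  · simp [hw, hw.ne']
  · have h3 : w ∣ n - w ↔ w ∣ n := by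
      rw [Nat.dvd_sub_iff_left h.le dvd_rfl]
    rw [if_neg h.ne', if_neg (by omega : ¬ n = 0), if_pos h.le]
    simp only [h3, (by omega : 0 < n), (by omega : 0 < n - w)]
    simp

/-- Multiplication by `1 - X^w` multiplies the value at `x` by `1 - x^w`. -/
lemma hasSum_mul_one_sub_X_pow {f : PowerSeries ℝ} {x a : ℝ} (w : ℕ)
    (hf : HasSum (fun n => PowerSeries.coeff n f * x ^ n) a) :
    HasSum (fun n => PowerSeries.coeff n (f * (1 - PowerSeries.X ^ w)) * x ^ n)
      (a * (1 - x ^ w)) := by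
  have h1 : HasSum (fun n => PowerSeries.coeff n (f * PowerSeries.X ^ w) * x ^ n) (a * x ^ w) := by
    rw [← hasSum_nat_add_iff' w]
    rw [Finset.sum_eq_zero, sub_zero]
    · refine (hf.mul_right (x ^ w)).congr_fun ?_
      intro n
      rw [PowerSeries.coeff_mul_X_pow, pow_add]
      ring
    · intro i hi
      rw [PowerSeries.coeff_mul_X_pow', if_neg (by simpa using hi), zero_mul]
  have h2 := hf.sub h1
  rw [show a * (1 - x ^ w) = a - a * x ^ w by ring]
  refine h2.congr_fun fun n => ?_
  rw [mul_sub, mul_one, map_sub, sub_mul]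

/-! ### Sums over monic polynomials -/

section MonicSums

open Polynomial UniqueFactorizationMonoid

variable (F : Type*) [Field F] [Fintype F]

lemma finite_setOf_monic_natDegree_eq (n : ℕ) :
    {f : F[X] | f.Monic ∧ f.natDegree = n}.Finite := by
  have : Finite (degreeLT F n) := Finite.of_equiv (Fin n → F) (degreeLTEquiv F n).toEquiv.symm
  exact Finite.of_equiv _ (monicEquivDegreeLT n).symm

/-- The monic polynomials of degree `n`. -/
noncomputable def monicsOfDegree (n : ℕ) : Finset F[X] :=
  (finite_setOf_monic_natDegree_eq F n).toFinset

variable {F} in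
@[simp]
lemma mem_monicsOfDegree {n : ℕ} {f : F[X]} :
    f ∈ monicsOfDegree F n ↔ f.Monic ∧ f.natDegree = n := by
  simp [monicsOfDegree]

lemma card_monicsOfDegree (n : ℕ) : (monicsOfDegree F n).card = Fintype.card F ^ n := by
  rw [monicsOfDegree, ← Nat.card_eq_card_finite_toFinset, ← Nat.card_eq_fintype_card]
  calc Nat.card {f : F[X] | f.Monic ∧ f.natDegree = n} = Nat.card (Fin n → F) :=
        Nat.card_congr ((monicEquivDegreeLT n).trans (degreeLTEquiv F n).toEquiv)
    _ = Nat.card F ^ n := by simp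

open Classical in
/-- The monic irreducible polynomials whose degree divides `j` (none if `j = 0`). -/
noncomputable def primesOfDegreeDvd (j : ℕ) : Finset F[X] :=
  {P ∈ j.divisors.biUnion (monicsOfDegree F) | Irreducible P}

variable {F} in
@[simp]
lemma mem_primesOfDegreeDvd {j : ℕ} {P : F[X]} :
    P ∈ primesOfDegreeDvd F j ↔ P.Monic ∧ Irreducible P ∧ P.natDegree ∣ j ∧ j ≠ 0 := by
  simp only [primesOfDegreeDvd, Finset.mem_filter, Finset.mem_biUnion, Nat.mem_divisors,
    mem_monicsOfDegree]
  constructor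
  · rintro ⟨⟨d, ⟨h1, h2⟩, h3, rfl⟩, h4⟩
    exact ⟨h3, h4, h1, h2⟩
  · rintro ⟨h1, h2, h3, h4⟩
    exact ⟨⟨_, ⟨h3, h4⟩, h1, rfl⟩, h2⟩

open Classical in
/-- The monic irreducible polynomials of degree at most `n`. -/
noncomputable def primesOfDegreeLE (n : ℕ) : Finset F[X] :=
  {P ∈ (Finset.range (n + 1)).biUnion (monicsOfDegree F) | Irreducible P}

variable {F} in
@[simp]
lemma mem_primesOfDegreeLE {n : ℕ} {P : F[X]} :
    P ∈ primesOfDegreeLE F n ↔ P.Monic ∧ Irreducible P ∧ P.natDegree ≤ n := by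
  simp only [primesOfDegreeLE, Finset.mem_filter, Finset.mem_biUnion, Finset.mem_range,
    mem_monicsOfDegree]
  constructor
  · rintro ⟨⟨d, h1, h3, rfl⟩, h4⟩
    exact ⟨h3, h4, by omega⟩
  · rintro ⟨h1, h2, h3⟩
    exact ⟨⟨_, by omega, h1, rfl⟩, h2⟩

variable {F} in
/-- The generating series `∑_f a(f) X^{deg f}` over monic polynomials. -/
noncomputable def genSeries (a : F[X] → ℝ) : PowerSeries ℝ :=
  PowerSeries.mk fun n => ∑ f ∈ monicsOfDegree F n, a f

variable {F} in
/-- The series `∑_P ∑_{i ≥ 1} deg P α(P, i) X^{i deg P}` over monic irreducible polynomials. -/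
noncomputable def primeSeries (α : F[X] → ℕ → ℝ) : PowerSeries ℝ :=
  PowerSeries.mk fun j =>
    ∑ P ∈ primesOfDegreeDvd F j, (P.natDegree : ℝ) * α P (j / P.natDegree)

variable {F}

open Classical in
lemma sum_natDegree_mul_multiplicity {n : ℕ} {f : F[X]} (hf : f ∈ monicsOfDegree F n) :
    ∑ P ∈ primesOfDegreeLE F n, (P.natDegree : ℝ) * (multiplicity P f : ℝ) = n := by
  obtain ⟨hm, rfl⟩ := mem_monicsOfDegree.1 hf
  have hf0 : f ≠ 0 := hm.ne_zero
  have hprod : (normalizedFactors f).prod = f := by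
    rw [prod_normalizedFactors_eq hf0, hm.normalize_eq_self]
  have hmon : ∀ P ∈ normalizedFactors f, P.Monic := fun P hP => by
    rw [← normalize_normalized_factor P hP]
    exact monic_normalize (irreducible_of_normalized_factor P hP).ne_zero
  have hdeg : f.natDegree = ∑ P ∈ (normalizedFactors f).toFinset,
      (normalizedFactors f).count P * P.natDegree := by
    conv_lhs => rw [← hprod]
    rw [natDegree_multiset_prod_of_monic _ hmon, Finset.sum_multiset_map_count]
    simp
  have hcount : ∀ P ∈ primesOfDegreeLE F f.natDegree,
      multiplicity P f = (normalizedFactors f).count P := by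
    intro P hP
    obtain ⟨h1, h2, -⟩ := mem_primesOfDegreeLE.1 hP
    have hfin : FiniteMultiplicity P f :=
      finiteMultiplicity_of_degree_pos_of_monic (degree_pos_of_irreducible h2) h1 hf0
    have := emultiplicity_eq_count_normalizedFactors h2 hf0
    rw [h1.normalize_eq_self, hfin.emultiplicity_eq_multiplicity] at this
    exact_mod_cast this
  have hsub : (normalizedFactors f).toFinset ⊆ primesOfDegreeLE F f.natDegree := by
    intro P hP
    rw [Multiset.mem_toFinset] at hP
    exact mem_primesOfDegreeLE.2 ⟨hmon P hP, irreducible_of_normalized_factor P hP,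
      natDegree_le_of_dvd (dvd_of_mem_normalizedFactors hP) hf0⟩
  conv_rhs => rw [hdeg]
  rw [Finset.sum_congr rfl fun P hP => by rw [hcount P hP]]
  rw [← Finset.sum_subset hsub]
  · push_cast
    exact Finset.sum_congr rfl fun P _ => mul_comm _ _
  · intro P _ hP
    rw [Multiset.mem_toFinset] at hP
    simp [Multiset.count_eq_zero_of_notMem hP]

open Classical in
lemma sum_filter_pow_dvd (a : F[X] → ℝ) {P : F[X]} (hP : P.Monic) (i n : ℕ) :
    ∑ f ∈ monicsOfDegree F n with P ^ i ∣ f, a (f /ₘ P ^ i) =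
      if i * P.natDegree ≤ n then ∑ g ∈ monicsOfDegree F (n - i * P.natDegree), a g else 0 := by
  have hPi : (P ^ i).Monic := hP.pow i
  have hd : (P ^ i).natDegree = i * P.natDegree := hP.natDegree_pow i
  split_ifs with h
  · refine Finset.sum_bij' (fun f _ => f /ₘ P ^ i) (fun g _ => P ^ i * g) ?_ ?_ ?_ ?_ ?_
    · intro f hf
      simp only [Finset.mem_filter, mem_monicsOfDegree] at hf ⊢
      obtain ⟨⟨h1, h2⟩, g, rfl⟩ := hf
      rw [mul_divByMonic_cancel_left _ hPi]
      have hg : g.Monic := hPi.of_mul_monic_left h1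
      refine ⟨hg, ?_⟩
      rw [hPi.natDegree_mul hg, hd] at h2
      omega
    · intro g hg
      simp only [Finset.mem_filter, mem_monicsOfDegree] at hg ⊢
      refine ⟨⟨hPi.mul hg.1, ?_⟩, dvd_mul_right _ _⟩
      rw [hPi.natDegree_mul hg.1, hd, hg.2]
      omega
    · intro f hf
      simp only [Finset.mem_filter] at hf
      obtain ⟨_, g, rfl⟩ := hf
      rw [mul_divByMonic_cancel_left _ hPi]
    · intro g _
      exact mul_divByMonic_cancel_left _ hPi
    · intro f _
      rfl
  · rw [Finset.sum_eq_zero]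
    intro f hf
    simp only [Finset.mem_filter, mem_monicsOfDegree] at hf
    have := natDegree_le_of_dvd hf.2 hf.1.1.ne_zero
    omega

open Classical in
lemma multiplicity_mul_eq_sum {a : F[X] → ℝ} {α : ℕ → ℝ} {P : F[X]} (hP : P.Monic)
    (hPi : Irreducible P)
    (h : ∀ g : F[X], g.Monic → ¬ P ∣ g → ∀ v : ℕ,
      v * a (P ^ v * g) = ∑ i ∈ Finset.Icc 1 v, α i * a (P ^ (v - i) * g))
    {n : ℕ} {f : F[X]} (hf : f ∈ monicsOfDegree F n) :
    multiplicity P f * a f =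
      ∑ i ∈ Finset.Icc 1 n, if P ^ i ∣ f then α i * a (f /ₘ P ^ i) else 0 := by
  obtain ⟨hm, rfl⟩ := mem_monicsOfDegree.1 hf
  have hfin : FiniteMultiplicity P f :=
    finiteMultiplicity_of_degree_pos_of_monic (degree_pos_of_irreducible hPi) hP hm.ne_zero
  obtain ⟨g, hg, hPg⟩ := hfin.exists_eq_pow_mul_and_not_dvd
  set v := multiplicity P f
  have hgm : g.Monic := (hP.pow v).of_mul_monic_left (hg ▸ hm)
  have hv : v ≤ f.natDegree := by
    have h1 := congrArg natDegree hg
    rw [(hP.pow v).natDegree_mul hgm, hP.natDegree_pow] at h1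
    nlinarith [hPi.natDegree_pos]
  have hiff : ∀ i, P ^ i ∣ f ↔ i ≤ v := fun i => hfin.pow_dvd_iff_le_multiplicity
  conv_lhs => rw [hg]
  rw [h g hgm hPg v, ← Finset.sum_filter]
  refine Finset.sum_congr ?_ ?_
  · ext i
    simp only [Finset.mem_Icc, Finset.mem_filter, hiff]
    omega
  · intro i hi
    simp only [Finset.mem_filter, hiff] at hi
    congr 2
    conv_rhs => rw [hg, ← Nat.add_sub_cancel' hi.2, pow_add, mul_assoc,
      mul_divByMonic_cancel_left _ (hP.pow i)]

/-- The logarithmic derivative of the generating series of a function on monic polynomials, given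
its behaviour at each prime. -/
theorem hasLogDeriv_genSeries {a : F[X] → ℝ} {α : F[X] → ℕ → ℝ}
    (h : ∀ P : F[X], P.Monic → Irreducible P → ∀ g : F[X], g.Monic → ¬ P ∣ g → ∀ v : ℕ,
      v * a (P ^ v * g) = ∑ i ∈ Finset.Icc 1 v, α P i * a (P ^ (v - i) * g)) :
    HasLogDeriv (genSeries a) (primeSeries α) := by
  classical
  rw [hasLogDeriv_iff]
  intro n
  have hlhs : (n : ℝ) * ∑ f ∈ monicsOfDegree F n, a f =
      ∑ P ∈ primesOfDegreeLE F n, ∑ i ∈ Finset.Icc 1 n with i * P.natDegree ≤ n,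
        (P.natDegree : ℝ) * α P i * ∑ g ∈ monicsOfDegree F (n - i * P.natDegree), a g := by
    calc (n : ℝ) * ∑ f ∈ monicsOfDegree F n, a f
        = ∑ f ∈ monicsOfDegree F n, ∑ P ∈ primesOfDegreeLE F n,
            (P.natDegree : ℝ) * (multiplicity P f * a f) := by
          rw [Finset.mul_sum]
          refine Finset.sum_congr rfl fun f hf => ?_
          rw [← sum_natDegree_mul_multiplicity hf, Finset.sum_mul]
          exact Finset.sum_congr rfl fun P _ => mul_assoc _ _ _
      _ = ∑ P ∈ primesOfDegreeLE F n, ∑ f ∈ monicsOfDegree F n, ∑ i ∈ Finset.Icc 1 n,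
            if P ^ i ∣ f then (P.natDegree : ℝ) * α P i * a (f /ₘ P ^ i) else 0 := by
          rw [Finset.sum_comm]
          refine Finset.sum_congr rfl fun P hP => Finset.sum_congr rfl fun f hf => ?_
          obtain ⟨h1, h2, -⟩ := mem_primesOfDegreeLE.1 hP
          rw [multiplicity_mul_eq_sum h1 h2 (h P h1 h2) hf, Finset.mul_sum]
          refine Finset.sum_congr rfl fun i _ => ?_
          split_ifs
          · ring
          · simp
      _ = _ := by
          refine Finset.sum_congr rfl fun P hP => ?_
          obtain ⟨h1, h2, -⟩ := mem_primesOfDegreeLE.1 hP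
          rw [Finset.sum_comm, Finset.sum_filter]
          refine Finset.sum_congr rfl fun i _ => ?_
          rw [← Finset.sum_filter, ← Finset.mul_sum, sum_filter_pow_dvd a h1]
          split_ifs <;> simp
  simp only [genSeries, primeSeries, PowerSeries.coeff_mk]
  rw [hlhs, Finset.sum_sigma', Finset.Nat.sum_antidiagonal_eq_sum_range_succ_mk]
  simp only [Finset.sum_mul]
  rw [Finset.sum_sigma']
  refine Finset.sum_bij' (fun x _ => ⟨x.2 * x.1.natDegree, x.1⟩)
    (fun y _ => ⟨y.2, y.1 / y.2.natDegree⟩) ?_ ?_ ?_ ?_ ?_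
  · rintro ⟨P, i⟩ hx
    simp only [Finset.mem_sigma, mem_primesOfDegreeLE, Finset.mem_filter, Finset.mem_Icc,
      Finset.mem_range, mem_primesOfDegreeDvd] at hx ⊢
    obtain ⟨⟨h1, h2, h3⟩, ⟨h4, h5⟩, h6⟩ := hx
    have := h2.natDegree_pos
    exact ⟨by omega, h1, h2, dvd_mul_left _ _, by positivity⟩
  · rintro ⟨j, P⟩ hx
    simp only [Finset.mem_sigma, mem_primesOfDegreeLE, Finset.mem_filter, Finset.mem_Icc,
      Finset.mem_range, mem_primesOfDegreeDvd] at hx ⊢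
    obtain ⟨h0, h1, h2, h3, h4⟩ := hx
    have h5 := Nat.le_of_dvd (Nat.pos_of_ne_zero h4) h3
    refine ⟨⟨h1, h2, by omega⟩, ⟨Nat.div_pos h5 h2.natDegree_pos, ?_⟩, ?_⟩
    · exact (Nat.div_le_self _ _).trans (by omega)
    · rw [Nat.div_mul_cancel h3]
      omega
  · rintro ⟨P, i⟩ hx
    simp only [Finset.mem_sigma, mem_primesOfDegreeLE] at hx
    simp [Nat.mul_div_cancel _ hx.1.2.1.natDegree_pos]
  · rintro ⟨j, P⟩ hx
    simp only [Finset.mem_sigma, mem_primesOfDegreeDvd] at hx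
    simp [Nat.div_mul_cancel hx.2.2.2.1]
  · rintro ⟨P, i⟩ hx
    simp only [Finset.mem_sigma, mem_primesOfDegreeLE] at hx
    simp [Nat.mul_div_cancel _ hx.1.2.1.natDegree_pos]

end MonicSums

/-! ### The form `A² + T B²` -/

section Representations

open Polynomial

variable {F : Type*} [Field F]

/-- `f` is of the form `A² + T B²`. -/
def IsRepr (f : F[X]) : Prop := ∃ A B : F[X], f = A ^ 2 + X * B ^ 2

/-- Substitution of `-S²` for `T`, which embeds `F[T]` into `F[S]`, where `S = √(-T)`. -/
noncomputable def substNegSq : F[X] →+* F[X] := compRingHom (-X ^ 2)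

/-- The automorphism `S ↦ -S` of `F[S]`. -/
noncomputable def conjX : F[X] →+* F[X] := compRingHom (-X)

lemma substNegSq_X : substNegSq (X : F[X]) = -X ^ 2 := by simp [substNegSq]

lemma conjX_X : conjX (X : F[X]) = -X := by simp [conjX]

lemma conjX_conjX (g : F[X]) : conjX (conjX g) = g := by
  simp [conjX, comp_assoc]

lemma conjX_substNegSq (f : F[X]) : conjX (substNegSq f) = substNegSq f := by
  simp [conjX, substNegSq, comp_assoc]

lemma natDegree_substNegSq (f : F[X]) : (substNegSq f).natDegree = 2 * f.natDegree := by
  simp [substNegSq, natDegree_comp, mul_comm]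

lemma substNegSq_injective : Function.Injective (substNegSq : F[X] →+* F[X]) := by
  rw [injective_iff_map_eq_zero]
  intro f hf
  have h1 := natDegree_substNegSq f
  rw [hf, natDegree_zero] at h1
  rw [eq_C_of_natDegree_eq_zero (by omega : f.natDegree = 0)] at hf ⊢
  simpa [substNegSq] using hf

lemma exists_eq_substNegSq_add (g : F[X]) :
    ∃ A B : F[X], g = substNegSq A + X * substNegSq B := by
  induction g using Polynomial.induction_on with
  | C a => exact ⟨C a, 0, by simp [substNegSq]⟩
  | add p q hp hq =>
    obtain ⟨A, B, rfl⟩ := hp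
    obtain ⟨A', B', rfl⟩ := hq
    exact ⟨A + A', B + B', by rw [map_add, map_add]; ring⟩
  | monomial n a h =>
    obtain ⟨A, B, h⟩ := h
    refine ⟨-X * B, A, ?_⟩
    rw [pow_succ, ← mul_assoc, h, map_mul, map_neg, substNegSq_X]
    ring

lemma mul_conjX_eq (A B : F[X]) :
    (substNegSq A + X * substNegSq B) * conjX (substNegSq A + X * substNegSq B) =
      substNegSq (A ^ 2 + X * B ^ 2) := by
  simp only [map_add, map_mul, map_pow, conjX_substNegSq, conjX_X, substNegSq_X]
  ring

lemma exists_substNegSq_eq_mul_conjX (g : F[X]) :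
    ∃ k, IsRepr k ∧ substNegSq k = g * conjX g := by
  obtain ⟨A, B, rfl⟩ := exists_eq_substNegSq_add g
  exact ⟨_, ⟨A, B, rfl⟩, (mul_conjX_eq A B).symm⟩

lemma isRepr_iff (f : F[X]) : IsRepr f ↔ ∃ g, substNegSq f = g * conjX g := by
  constructor
  · rintro ⟨A, B, rfl⟩
    exact ⟨_, (mul_conjX_eq A B).symm⟩
  · rintro ⟨g, hg⟩
    obtain ⟨k, hk, h⟩ := exists_substNegSq_eq_mul_conjX g
    rwa [substNegSq_injective (hg.trans h.symm)]

lemma IsRepr.mul {f g : F[X]} (hf : IsRepr f) (hg : IsRepr g) : IsRepr (f * g) := by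
  rw [isRepr_iff] at *
  obtain ⟨u, hu⟩ := hf
  obtain ⟨v, hv⟩ := hg
  exact ⟨u * v, by rw [map_mul, map_mul, hu, hv]; ring⟩

lemma isRepr_X : IsRepr (X : F[X]) := ⟨0, 1, by simp⟩

lemma isUnit_of_isUnit_substNegSq {f : F[X]} (h : IsUnit (substNegSq f)) : IsUnit f := by
  have h1 := natDegree_substNegSq f
  rw [natDegree_eq_zero_of_isUnit h] at h1
  refine (isUnit_iff_degree_eq_zero).2 ?_
  rw [degree_eq_natDegree, (by omega : f.natDegree = 0)]
  · rfl
  · rintro rfl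
    simp at h

lemma isUnit_conjX {g : F[X]} (h : IsUnit g) : IsUnit (conjX g) := h.map conjX

lemma conjX_dvd {f g : F[X]} (h : f ∣ conjX g) : conjX f ∣ g := by
  have := map_dvd conjX h
  rwa [conjX_conjX] at this

lemma IsRepr.of_mul_left {P h : F[X]} (hP : Irreducible P) (hr : IsRepr P)
    (hPh : IsRepr (P * h)) : IsRepr h := by
  obtain ⟨w, hw⟩ := (isRepr_iff P).1 hr
  have hw0 : w ≠ 0 := by
    rintro rfl
    rw [zero_mul, ← map_zero substNegSq] at hw
    exact hP.ne_zero (substNegSq_injective hw)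
  have hnorm : ∀ u k : F[X], substNegSq k = u * conjX u → IsUnit k → IsUnit u := fun u k h1 h2 =>
    isUnit_of_mul_isUnit_left (h1 ▸ h2.map substNegSq)
  have hirr : Irreducible w := by
    refine ⟨fun hu => hP.not_isUnit (isUnit_of_isUnit_substNegSq ?_), fun u v huv => ?_⟩
    · rw [hw]
      exact hu.mul (isUnit_conjX hu)
    · obtain ⟨k, -, hk⟩ := exists_substNegSq_eq_mul_conjX u
      obtain ⟨l, -, hl⟩ := exists_substNegSq_eq_mul_conjX v
      have : P = k * l := substNegSq_injective (by
        rw [map_mul, hw, hk, hl, huv, map_mul]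
        ring)
      exact (hP.isUnit_or_isUnit this).imp (hnorm u k hk) (hnorm v l hl)
  obtain ⟨y, hy⟩ := (isRepr_iff _).1 hPh
  have key : ∀ y, substNegSq (P * h) = y * conjX y → w ∣ y → IsRepr h := by
    rintro _ hy ⟨z, rfl⟩
    refine (isRepr_iff h).2 ⟨z, ?_⟩
    rw [map_mul, map_mul, hw] at hy
    have h0 : w * conjX w ≠ 0 := by
      rw [← hw, ← map_zero substNegSq]
      exact substNegSq_injective.ne hP.ne_zero
    apply mul_left_cancel₀ h0
    rw [hy]
    ring
  have hdvd : w ∣ y * conjX y := by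
    rw [← hy, map_mul, hw, mul_assoc]
    exact dvd_mul_right _ _
  rcases hirr.prime.dvd_or_dvd hdvd with h1 | h1
  · exact key y hy h1
  · exact key (conjX y) (by rw [hy, conjX_conjX, mul_comm]) h1

lemma IsRepr.exists_eq_mul_of_irreducible {P h : F[X]} (hP : Irreducible (substNegSq P))
    (hPh : IsRepr (P * h)) : ∃ k, h = P * k ∧ IsRepr k := by
  obtain ⟨y, hy⟩ := (isRepr_iff _).1 hPh
  have hdvd : substNegSq P ∣ y * conjX y := by
    rw [← hy, map_mul]
    exact dvd_mul_right _ _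
  have h1 : substNegSq P ∣ y := by
    rcases hP.prime.dvd_or_dvd hdvd with h1 | h1
    · exact h1
    · rw [← conjX_substNegSq]
      exact conjX_dvd h1
  obtain ⟨z, rfl⟩ := h1
  obtain ⟨k, hk, hkz⟩ := exists_substNegSq_eq_mul_conjX z
  refine ⟨k, substNegSq_injective ?_, hk⟩
  rw [map_mul, map_mul, conjX_substNegSq] at hy
  apply mul_left_cancel₀ hP.ne_zero
  rw [hy, map_mul, hkz]
  ring

lemma isSquare_leadingCoeff_of_isRepr {f : F[X]} (hf : IsRepr f) : IsSquare f.leadingCoeff := by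
  obtain ⟨A, B, rfl⟩ := hf
  rcases eq_or_ne A 0 with rfl | hA
  · exact ⟨B.leadingCoeff, by simp [pow_two]⟩
  rcases eq_or_ne B 0 with rfl | hB
  · exact ⟨A.leadingCoeff, by simp [pow_two]⟩
  have h1 : (A ^ 2).natDegree = 2 * A.natDegree := natDegree_pow _ _
  have h2 : (X * B ^ 2).natDegree = 2 * B.natDegree + 1 := by
    rw [natDegree_X_mul (pow_ne_zero _ hB), natDegree_pow]
  rcases lt_or_gt_of_ne (by omega : (A ^ 2).natDegree ≠ (X * B ^ 2).natDegree) with h | h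
  · rw [leadingCoeff_add_of_degree_lt (degree_lt_degree h)]
    exact ⟨B.leadingCoeff, by simp [pow_two]⟩
  · rw [leadingCoeff_add_of_degree_lt' (degree_lt_degree h)]
    exact ⟨A.leadingCoeff, by simp [pow_two]⟩

lemma isRepr_of_mul_isUnit {P m : F[X]} (hP : P.Monic) (hm : IsUnit m) (h : IsRepr (P * m)) :
    IsRepr P := by
  obtain ⟨c, hc, rfl⟩ := isUnit_iff.1 hm
  obtain ⟨e, he⟩ := isSquare_leadingCoeff_of_isRepr h
  rw [leadingCoeff_mul, hP.leadingCoeff, one_mul, leadingCoeff_C] at he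
  obtain ⟨A, B, hAB⟩ := h
  have he0 : e ≠ 0 := by
    rintro rfl
    simp [he] at hc
  refine ⟨A * C e⁻¹, B * C e⁻¹, ?_⟩
  have h1 : C e * C e⁻¹ = (1 : F[X]) := by rw [← C_mul, mul_inv_cancel₀ he0, C_1]
  rw [he, C_mul] at hAB
  linear_combination (C e⁻¹ ^ 2) * hAB - P * (C e * C e⁻¹ + 1) * h1

lemma irreducible_substNegSq_or_isRepr {P : F[X]} (hP : P.Monic) (hi : Irreducible P) :
    Irreducible (substNegSq P) ∨ IsRepr P := by
  by_cases h : Irreducible (substNegSq P)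
  · exact Or.inl h
  right
  rw [irreducible_iff] at h
  push Not at h
  obtain ⟨u, v, huv, hu, hv⟩ := h fun h => hi.not_isUnit (isUnit_of_isUnit_substNegSq h)
  have hnorm : ∀ u k : F[X], substNegSq k = u * conjX u → ¬ IsUnit u → ¬ IsUnit k :=
    fun u k h1 h2 h3 => h2 (isUnit_of_mul_isUnit_left (h1 ▸ h3.map substNegSq))
  obtain ⟨k, hk, hku⟩ := exists_substNegSq_eq_mul_conjX u
  obtain ⟨l, hl, hlv⟩ := exists_substNegSq_eq_mul_conjX v
  have hkl : P * P = k * l := substNegSq_injective (by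
    rw [map_mul, map_mul, hku, hlv]
    nth_rewrite 2 [← conjX_substNegSq]
    rw [huv, map_mul]
    ring)
  have key : ∀ k l : F[X], P * P = k * l → IsRepr k → ¬ IsUnit l → P ∣ k → IsRepr P := by
    rintro _ l hkl hk hl ⟨m, rfl⟩
    have : P = m * l := mul_left_cancel₀ hi.ne_zero (by rw [hkl, mul_assoc])
    exact isRepr_of_mul_isUnit hP ((hi.isUnit_or_isUnit this).resolve_right hl) hk
  rcases hi.prime.dvd_or_dvd (hkl ▸ dvd_mul_right P P) with h1 | h1
  · exact key k l hkl hk (hnorm v l hlv hv) h1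
  · exact key l k (by rw [hkl, mul_comm]) hl (hnorm u k hku hu) h1

lemma IsRepr.isSquare_coeff_zero {f : F[X]} (hf : IsRepr f) : IsSquare (f.coeff 0) := by
  obtain ⟨A, B, rfl⟩ := hf
  exact ⟨A.coeff 0, by simp [pow_two, mul_coeff_zero]⟩

/-- The quadratic reciprocity law for `-T` modulo a monic irreducible polynomial. -/
lemma exists_dvd_sq_add_X [Fintype F] (hq : Odd (Fintype.card F)) {P : F[X]} (hP : P.Monic)
    (hi : Irreducible P) (h0 : P.coeff 0 ≠ 0) (hs : IsSquare (P.coeff 0)) :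
    ∃ h : F[X], P ∣ h ^ 2 + X := by
  classical
  have : Fact (Irreducible P) := ⟨hi⟩
  have : Module.Finite F (AdjoinRoot P) := hP.finite_adjoinRoot
  have : Finite (AdjoinRoot P) := Module.finite_of_finite F
  have := Fintype.ofFinite (AdjoinRoot P)
  have hnorm : Algebra.norm F (-AdjoinRoot.root P) = P.coeff 0 := by
    have h1 := Algebra.PowerBasis.norm_gen_eq_coeff_zero_minpoly (AdjoinRoot.powerBasis hi.ne_zero)
    rw [AdjoinRoot.powerBasis_gen, AdjoinRoot.minpoly_root hi.ne_zero, hP.leadingCoeff, inv_one,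
      C_1, mul_one] at h1
    rw [← neg_one_mul, map_mul, h1, show (-1 : AdjoinRoot P) = algebraMap F _ (-1) by simp,
      Algebra.norm_algebraMap, (AdjoinRoot.powerBasis hi.ne_zero).finrank, ← mul_assoc,
      ← mul_pow]
    simp
  have hx0 : -AdjoinRoot.root P ≠ 0 := by
    intro h
    rw [h, Algebra.norm_zero] at hnorm
    exact h0 hnorm.symm
  have hcard : Fintype.card (AdjoinRoot P) =
      Fintype.card F ^ Module.finrank F (AdjoinRoot P) := Module.card_eq_pow_finrank
  have hQ : Odd (Fintype.card (AdjoinRoot P)) := hcard ▸ hq.pow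
  have hcF : ringChar F ≠ 2 := fun h => by
    have := FiniteField.even_card_of_char_two h
    have := Nat.odd_iff.1 hq
    omega
  have hcK : ringChar (AdjoinRoot P) ≠ 2 := fun h => by
    have := FiniteField.even_card_of_char_two h
    have := Nat.odd_iff.1 hQ
    omega
  have hsq : IsSquare (-AdjoinRoot.root P) := by
    rw [FiniteField.isSquare_iff hcK hx0]
    have h1 := (FiniteField.isSquare_iff hcF h0).1 hs
    have h2 := FiniteField.algebraMap_norm_eq_pow (K := F) (x := -AdjoinRoot.root P)
    rw [hnorm] at h2
    have h3 := congrArg (algebraMap F (AdjoinRoot P)) h1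
    rw [map_pow, h2, map_one, ← pow_mul, Nat.card_eq_fintype_card, Nat.card_eq_fintype_card] at h3
    have h4 : Fintype.card F - 1 ∣ Fintype.card (AdjoinRoot P) - 1 := by
      rw [hcard]
      simpa using Nat.sub_dvd_pow_sub_pow (Fintype.card F) 1 (Module.finrank F (AdjoinRoot P))
    have h5 := Nat.div_mul_cancel h4
    convert h3 using 2
    obtain ⟨r, hr⟩ := hq
    obtain ⟨s, hs⟩ := hQ
    have h6 : Fintype.card F / 2 = r := by omega
    have h7 : Fintype.card F - 1 = 2 * r := by omega
    rw [h6]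
    rw [h7] at h5 ⊢
    set m := (Fintype.card (AdjoinRoot P) - 1) / (2 * r)
    have h8 : 2 * (m * r) = 2 * s := by
      rw [← mul_assoc, mul_comm 2 m, mul_assoc, h5]
      omega
    omega
  obtain ⟨β, hβ⟩ := hsq
  obtain ⟨h, rfl⟩ := AdjoinRoot.mk_surjective β
  refine ⟨h, AdjoinRoot.mk_eq_zero.1 ?_⟩
  rw [map_add, map_pow, AdjoinRoot.mk_X, pow_two, ← hβ, neg_add_cancel]

lemma isRepr_of_isSquare_coeff_zero [Fintype F] (hq : Odd (Fintype.card F)) {P : F[X]}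
    (hP : P.Monic) (hi : Irreducible P) (hs : IsSquare (P.coeff 0)) : IsRepr P := by
  by_cases h0 : P.coeff 0 = 0
  · have h1 : (X : F[X]) ∣ P := X_dvd_iff.2 h0
    rw [← eq_of_monic_of_associated monic_X hP
      ((irreducible_X.associated_of_dvd hi h1))]
    exact isRepr_X
  refine (irreducible_substNegSq_or_isRepr hP hi).resolve_left fun hirr => ?_
  obtain ⟨h, hh⟩ := exists_dvd_sq_add_X hq hP hi h0 hs
  have h1 : substNegSq P ∣ (substNegSq h - X) * (substNegSq h + X) := by
    have := map_dvd substNegSq hh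
    rw [map_add, map_pow, substNegSq_X] at this
    convert this using 1
    ring
  have key : substNegSq P ∣ substNegSq h - X ∧ substNegSq P ∣ substNegSq h + X := by
    rcases hirr.prime.dvd_or_dvd h1 with h2 | h2
    · refine ⟨h2, ?_⟩
      have := map_dvd conjX h2
      simpa [conjX_substNegSq, conjX_X] using this
    · refine ⟨?_, h2⟩
      have := map_dvd conjX h2
      simpa [conjX_substNegSq, conjX_X, sub_eq_add_neg] using this
  have h2 : substNegSq P ∣ C 2 * X := by
    have := dvd_sub key.2 key.1
    convert this using 1
    rw [C_ofNat]
    ring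
  have h20 : (2 : F) ≠ 0 := by
    refine Ring.two_ne_zero fun h => ?_
    have := FiniteField.even_card_of_char_two h
    have := Nat.odd_iff.1 hq
    omega
  have h3 := natDegree_le_of_dvd h2 (mul_ne_zero (C_ne_zero.2 h20) X_ne_zero)
  rw [natDegree_C_mul_X _ h20, natDegree_substNegSq] at h3
  have := hi.natDegree_pos
  omega

lemma isRepr_mul_iff_of_isSquare [Fintype F] (hq : Odd (Fintype.card F)) {P : F[X]}
    (hP : P.Monic) (hi : Irreducible P) (hs : IsSquare (P.coeff 0)) (g : F[X]) :
    IsRepr (P * g) ↔ IsRepr g :=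
  have hr := isRepr_of_isSquare_coeff_zero hq hP hi hs
  ⟨fun h => IsRepr.of_mul_left hi hr h, fun h => hr.mul h⟩

lemma isRepr_mul_iff_of_not_isSquare {P : F[X]} (hP : P.Monic) (hi : Irreducible P)
    (hs : ¬ IsSquare (P.coeff 0)) (g : F[X]) : IsRepr (P * g) ↔ ∃ k, g = P * k ∧ IsRepr k := by
  constructor
  · exact fun h => h.exists_eq_mul_of_irreducible
      ((irreducible_substNegSq_or_isRepr hP hi).resolve_right fun h => hs h.isSquare_coeff_zero)
  · rintro ⟨k, rfl, hk⟩
    rw [← mul_assoc]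
    exact IsRepr.mul ⟨P, 0, by ring⟩ hk

lemma isRepr_pow_mul_iff_of_isSquare [Fintype F] (hq : Odd (Fintype.card F)) {P : F[X]}
    (hP : P.Monic) (hi : Irreducible P) (hs : IsSquare (P.coeff 0)) (g : F[X]) (v : ℕ) :
    IsRepr (P ^ v * g) ↔ IsRepr g := by
  induction v with
  | zero => simp
  | succ v ih => rw [pow_succ', mul_assoc, isRepr_mul_iff_of_isSquare hq hP hi hs, ih]

lemma isRepr_pow_mul_iff_of_not_isSquare {P : F[X]} (hP : P.Monic) (hi : Irreducible P)
    (hs : ¬ IsSquare (P.coeff 0)) {g : F[X]} (hg : ¬ P ∣ g) (v : ℕ) :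
    IsRepr (P ^ v * g) ↔ Even v ∧ IsRepr g := by
  induction v using Nat.twoStepInduction with
  | zero => simp
  | one =>
    rw [pow_one, isRepr_mul_iff_of_not_isSquare hP hi hs]
    constructor
    · rintro ⟨k, rfl, -⟩
      exact absurd (dvd_mul_right _ _) hg
    · simp
  | more v ih _ =>
    rw [pow_succ', mul_assoc, isRepr_mul_iff_of_not_isSquare hP hi hs, Nat.even_add,
      pow_succ', mul_assoc]
    simp only [mul_right_inj' hi.ne_zero, exists_eq_left', ih]
    simp

open Classical in
/-- The indicator function of the polynomials of the form `A² + T B²`. -/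
noncomputable def reprIndicator (f : F[X]) : ℝ := if IsRepr f then 1 else 0

open Classical in
lemma reprIndicator_local [Fintype F] (hq : Odd (Fintype.card F)) {P : F[X]} (hP : P.Monic)
    (hi : Irreducible P) {g : F[X]} (hg : ¬ P ∣ g) (v : ℕ) :
    v * reprIndicator (P ^ v * g) = ∑ i ∈ Finset.Icc 1 v,
      (if IsSquare (P.coeff 0) then 1 else 1 + (-1) ^ i) * reprIndicator (P ^ (v - i) * g) := by
  by_cases hs : IsSquare (P.coeff 0)
  · simp [reprIndicator, isRepr_pow_mul_iff_of_isSquare hq hP hi hs, hs]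
  · have h1 : ∀ v, reprIndicator (P ^ v * g) = (1 + (-1) ^ v) / 2 * reprIndicator g := by
      intro v
      simp only [reprIndicator, isRepr_pow_mul_iff_of_not_isSquare hP hi hs hg]
      rcases Nat.even_or_odd v with h | h
      · simp [h]
      · simp [h, Nat.not_even_iff_odd.2 h]
    have h2 : ∀ v : ℕ, ∑ i ∈ Finset.Icc 1 v, (1 + (-1 : ℝ) ^ i) = v + ((-1) ^ v - 1) / 2 := by
      intro v
      induction v with
      | zero => simp
      | succ v ih =>
        rw [Finset.sum_Icc_succ_top (by omega), ih, pow_succ]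
        push_cast
        ring
    have h3 : ((-1 : ℝ) ^ v) ^ 2 = 1 := by rw [← pow_mul, mul_comm, pow_mul]; simp
    simp only [hs, if_false, h1]
    have h4 : ∀ i ∈ Finset.Icc 1 v,
        (1 + (-1 : ℝ) ^ i) * ((1 + (-1) ^ (v - i)) / 2 * reprIndicator g) =
          (1 + (-1) ^ i) * ((1 + (-1) ^ v) / 2 * reprIndicator g) := by
      intro i hi
      rw [Finset.mem_Icc] at hi
      have h5 : (-1 : ℝ) ^ v = (-1) ^ (v - i) * (-1) ^ i := by
        rw [← pow_add, Nat.sub_add_cancel hi.2]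
      rcases Nat.even_or_odd i with h | h
      · rw [h5, h.neg_one_pow]
        ring
      · rw [h.neg_one_pow]
        ring
    rw [Finset.sum_congr rfl h4, ← Finset.sum_mul, h2]
    linear_combination (-reprIndicator g / 4) * h3

end Representations

/-! ### The coefficients of `(1 - X)^{-1/2}` -/

/-- The coefficient of `X^n` in `(1 - X)^{-1/2}`. -/
noncomputable def halfBinom (n : ℕ) : ℝ := rbinom ((n : ℝ) - 1 / 2) n

lemma halfBinom_zero : halfBinom 0 = 1 := by simp [halfBinom, rbinom]

lemma halfBinom_succ (n : ℕ) :
    halfBinom (n + 1) = halfBinom n * ((2 * n + 1) / (2 * n + 2)) := by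
  unfold halfBinom rbinom
  rw [Finset.prod_range_succ', Nat.factorial_succ]
  have h : ∏ i ∈ Finset.range n, (((n + 1 : ℕ) : ℝ) - 1 / 2 - ((i + 1 : ℕ) : ℝ)) =
      ∏ i ∈ Finset.range n, ((n : ℝ) - 1 / 2 - (i : ℝ)) := by
    refine Finset.prod_congr rfl fun i _ => ?_
    push_cast
    ring
  rw [h]
  have h1 : (Nat.factorial n : ℝ) ≠ 0 := by positivity
  have h2 : (n : ℝ) + 1 ≠ 0 := by positivity
  push_cast
  field_simp
  ring

lemma halfBinom_pos (n : ℕ) : 0 < halfBinom n := by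
  induction n with
  | zero => simp [halfBinom_zero]
  | succ n ih => rw [halfBinom_succ]; positivity

lemma halfBinom_sq_mul_le (n : ℕ) : halfBinom n ^ 2 * (n + 1) ≤ 1 := by
  induction n with
  | zero => simp [halfBinom_zero]
  | succ n ih =>
    refine le_trans ?_ ih
    rw [halfBinom_succ, mul_pow, mul_assoc]
    refine mul_le_mul_of_nonneg_left ?_ (sq_nonneg _)
    rw [div_pow, div_mul_eq_mul_div, div_le_iff₀ (by positivity)]
    push_cast
    have : (0 : ℝ) ≤ n := Nat.cast_nonneg n
    nlinarith

lemma halfBinom_le_rpow (n : ℕ) : halfBinom n ≤ ((n : ℝ) + 1) ^ (-(1 / 2) : ℝ) := by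
  have hn : (0 : ℝ) < (n : ℝ) + 1 := by positivity
  rw [Real.rpow_neg hn.le, ← Real.sqrt_eq_rpow, ← Real.sqrt_inv]
  apply Real.le_sqrt_of_sq_le
  rw [← one_div, le_div_iff₀ hn]
  exact halfBinom_sq_mul_le n

lemma halfBinom_sub_succ_le (n : ℕ) :
    halfBinom n - halfBinom (n + 1) ≤ (((n : ℝ) + 1) ^ (3 / 2 : ℝ))⁻¹ := by
  have hn : (0 : ℝ) < (n : ℝ) + 1 := by positivity
  calc halfBinom n - halfBinom (n + 1) = halfBinom n * (2 * ((n : ℝ) + 1))⁻¹ := by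
        rw [halfBinom_succ]
        field_simp
        ring
    _ ≤ ((n : ℝ) + 1) ^ (-(1 / 2) : ℝ) * ((n : ℝ) + 1)⁻¹ := by
        refine mul_le_mul (halfBinom_le_rpow n) ?_ (by positivity) (by positivity)
        exact inv_anti₀ hn (by linarith)
    _ = (((n : ℝ) + 1) ^ (3 / 2 : ℝ))⁻¹ := by
        rw [← Real.rpow_neg_one, ← Real.rpow_add hn, ← Real.rpow_neg hn.le]
        norm_num

lemma halfBinom_antitone : Antitone halfBinom := by
  refine antitone_nat_of_succ_le fun n => ?_
  rw [halfBinom_succ]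
  refine mul_le_of_le_one_right (halfBinom_pos n).le ?_
  rw [div_le_one (by positivity)]
  linarith

lemma rpow_three_halves_le_sq {x : ℝ} (hx : 1 ≤ x) : x ^ (3 / 2 : ℝ) ≤ x ^ 2 := by
  rw [← Real.rpow_natCast]
  exact Real.rpow_le_rpow_of_exponent_le hx (by norm_num)

lemma halfBinom_add_sub_le (m k : ℕ) :
    halfBinom m - halfBinom (m + k) ≤ k * (((m : ℝ) + 1) ^ (3 / 2 : ℝ))⁻¹ := by
  induction k with
  | zero => simp
  | succ k ih =>
    have h1 := halfBinom_sub_succ_le (m + k)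
    have h2 : ((((m + k : ℕ) : ℝ) + 1) ^ (3 / 2 : ℝ))⁻¹ ≤ (((m : ℝ) + 1) ^ (3 / 2 : ℝ))⁻¹ := by
      refine inv_anti₀ (by positivity) (Real.rpow_le_rpow (by positivity) ?_ (by norm_num))
      push_cast
      linarith [(Nat.cast_nonneg k : (0 : ℝ) ≤ k)]
    rw [← add_assoc]
    push_cast
    linarith

lemma abs_halfBinom_sub_le {n : ℕ} (hn : 0 < n) (k : ℕ) :
    |(if k ≤ n then halfBinom (n - k) else 0) - halfBinom n| ≤
      (k : ℝ) ^ 3 / (n : ℝ) ^ (3 / 2 : ℝ) := by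
  have hn1 : (1 : ℝ) ≤ n := by exact_mod_cast hn
  have hn0 : (0 : ℝ) < (n : ℝ) ^ (3 / 2 : ℝ) := by positivity
  split_ifs with h
  · rcases Nat.eq_zero_or_pos k with rfl | hk
    · simp
    have hk1 : (1 : ℝ) ≤ k := by exact_mod_cast hk
    rw [abs_of_nonneg (sub_nonneg.2 (halfBinom_antitone (Nat.sub_le n k)))]
    obtain ⟨m, rfl⟩ := Nat.exists_eq_add_of_le' h
    rw [Nat.add_sub_cancel]
    refine (halfBinom_add_sub_le m k).trans ?_
    have hm : (0 : ℝ) < ((m : ℝ) + 1) ^ (3 / 2 : ℝ) := by positivity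
    rw [← div_eq_mul_inv, div_le_div_iff₀ hm hn0]
    have h1 : ((m + k : ℕ) : ℝ) ≤ k * ((m : ℝ) + 1) := by
      push_cast
      nlinarith [(Nat.cast_nonneg m : (0 : ℝ) ≤ m)]
    have h2 : ((m + k : ℕ) : ℝ) ^ (3 / 2 : ℝ) ≤ k ^ 2 * ((m : ℝ) + 1) ^ (3 / 2 : ℝ) := by
      refine (Real.rpow_le_rpow (by positivity) h1 (by norm_num)).trans ?_
      rw [Real.mul_rpow (by positivity) (by positivity)]
      exact mul_le_mul_of_nonneg_right (rpow_three_halves_le_sq hk1) hm.le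
    calc (k : ℝ) * ((m + k : ℕ) : ℝ) ^ (3 / 2 : ℝ)
        ≤ k * (k ^ 2 * ((m : ℝ) + 1) ^ (3 / 2 : ℝ)) := by gcongr
      _ = k ^ 3 * ((m : ℝ) + 1) ^ (3 / 2 : ℝ) := by ring
  · have hk : (n : ℝ) ≤ k := by exact_mod_cast (not_le.1 h).le
    rw [zero_sub, abs_neg, abs_of_pos (halfBinom_pos n)]
    have h1 : halfBinom n ≤ 1 := halfBinom_zero ▸ halfBinom_antitone (Nat.zero_le n)
    refine h1.trans ?_
    rw [one_le_div hn0]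
    calc (n : ℝ) ^ (3 / 2 : ℝ) ≤ n ^ 2 := rpow_three_halves_le_sq hn1
      _ ≤ k ^ 2 := by gcongr
      _ ≤ k ^ 3 := pow_le_pow_right₀ (hn1.trans hk) (by norm_num)

/-- The series `∑_{j ≥ 1} q^j X^j`. -/
noncomputable def zetaLogDeriv (q : ℝ) : PowerSeries ℝ :=
  PowerSeries.mk fun j => if j = 0 then 0 else q ^ j

lemma hasLogDeriv_zeta (q : ℝ) : HasLogDeriv (PowerSeries.mk fun n => q ^ n) (zetaLogDeriv q) := by
  rw [hasLogDeriv_iff]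
  intro n
  simp only [zetaLogDeriv, PowerSeries.coeff_mk]
  cases n with
  | zero => simp
  | succ n =>
    rw [Finset.Nat.sum_antidiagonal_succ]
    simp only [if_true, zero_mul, zero_add, Nat.succ_ne_zero, if_false]
    rw [Finset.sum_congr rfl (g := fun _ => q ^ (n + 1))]
    · simp
    · rintro ⟨i, j⟩ hp
      rw [Finset.HasAntidiagonal.mem_antidiagonal] at hp
      simp only at hp ⊢
      rw [← pow_add, ← hp]
      ring_nf

lemma sum_halfBinom (n : ℕ) : ∑ m ∈ Finset.range n, halfBinom m = 2 * n * halfBinom n := by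
  induction n with
  | zero => simp
  | succ n ih =>
    rw [Finset.sum_range_succ, ih, halfBinom_succ]
    push_cast
    field_simp

/-- The series `(1 - qX)^{-1/2}`. -/
noncomputable def halfZeta (q : ℝ) : PowerSeries ℝ :=
  PowerSeries.mk fun n => halfBinom n * q ^ n

lemma hasLogDeriv_halfZeta (q : ℝ) :
    HasLogDeriv (halfZeta q) (PowerSeries.C (1 / 2) * zetaLogDeriv q) := by
  rw [hasLogDeriv_iff]
  intro n
  simp only [PowerSeries.coeff_C_mul]
  simp only [zetaLogDeriv, halfZeta, PowerSeries.coeff_mk]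
  cases n with
  | zero => simp
  | succ n =>
    rw [Finset.Nat.sum_antidiagonal_succ]
    simp only [if_true, zero_mul, zero_add, Nat.succ_ne_zero, if_false, mul_zero]
    rw [Finset.sum_congr rfl (g := fun p => 1 / 2 * q ^ (n + 1) * halfBinom p.2)]
    · rw [← Finset.mul_sum, ← Finset.Nat.sum_antidiagonal_swap]
      simp only [Prod.snd_swap]
      rw [Finset.Nat.sum_antidiagonal_eq_sum_range_succ_mk, sum_halfBinom]
      push_cast
      ring
    · rintro ⟨i, j⟩ hp
      rw [Finset.HasAntidiagonal.mem_antidiagonal] at hp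
      simp only at hp ⊢
      rw [← hp]
      ring

/-! ### Identities between the prime series -/

section PrimeSeries

open Polynomial

variable (F : Type*) [Field F] [Fintype F]

lemma coeff_zero_primeSeries (α : F[X] → ℕ → ℝ) : PowerSeries.coeff 0 (primeSeries α) = 0 := by
  have : primesOfDegreeDvd F 0 = ∅ := by
    ext P
    simp
  simp only [primeSeries, PowerSeries.coeff_mk, this, Finset.sum_empty]

lemma monicsOfDegree_zero : monicsOfDegree F 0 = {1} := by
  ext f
  rw [mem_monicsOfDegree, Finset.mem_singleton]
  constructor
  · rintro ⟨h1, h2⟩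
    exact h1.natDegree_eq_zero.1 h2
  · rintro rfl
    simp

lemma primeSeries_one :
    primeSeries (fun (_ : F[X]) _ => (1 : ℝ)) = zetaLogDeriv (Fintype.card F) := by
  have h1 : genSeries (fun _ : F[X] => (1 : ℝ)) =
      PowerSeries.mk fun n => (Fintype.card F : ℝ) ^ n := by
    ext n
    simp [genSeries, card_monicsOfDegree]
  refine HasLogDeriv.logDeriv_eq (f := genSeries fun _ : F[X] => (1 : ℝ))
    (hasLogDeriv_genSeries fun P _ _ g _ _ v => by simp) (h1 ▸ hasLogDeriv_zeta _) ?_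
  rw [h1]
  intro h
  have := congrArg (PowerSeries.coeff 0) h
  simp at this

lemma sum_natDegree_primesOfDegreeDvd {j : ℕ} (hj : j ≠ 0) :
    ∑ P ∈ primesOfDegreeDvd F j, (P.natDegree : ℝ) = (Fintype.card F : ℝ) ^ j := by
  have := congrArg (PowerSeries.coeff j) (primeSeries_one F)
  simpa [primeSeries, zetaLogDeriv, hj] using this

variable {F}

lemma ringChar_ne_two_of_odd_card (hq : Odd (Fintype.card F)) : ringChar F ≠ 2 := fun h => by
  have := FiniteField.even_card_of_char_two h
  have := Nat.odd_iff.1 hq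
  omega

open Classical in
lemma sum_quadraticChar_coeff_zero (hq : Odd (Fintype.card F)) {n : ℕ} (hn : 0 < n) :
    ∑ f ∈ monicsOfDegree F n, (quadraticChar F (f.coeff 0) : ℝ) = 0 := by
  have hshift : ∀ c : F, ∑ f ∈ monicsOfDegree F n, (quadraticChar F (f.coeff 0) : ℝ) =
      ∑ f ∈ monicsOfDegree F n, (quadraticChar F (f.coeff 0 + c) : ℝ) := by
    intro c
    have hmem : ∀ (c : F) (f : F[X]), f ∈ monicsOfDegree F n → f + C c ∈ monicsOfDegree F n := by
      intro c f hf
      rw [mem_monicsOfDegree] at hf ⊢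
      have hlt : (C c).degree < f.degree := by
        refine degree_C_le.trans_lt ?_
        rw [← natDegree_pos_iff_degree_pos, hf.2]
        exact hn
      exact ⟨hf.1.add_of_left hlt, by rw [natDegree_add_C, hf.2]⟩
    refine Finset.sum_bij' (fun f _ => f + C (-c)) (fun f _ => f + C c)
      (fun f hf => hmem _ f hf) (fun f hf => hmem _ f hf) ?_ ?_ ?_
    · intro f _
      simp
    · intro f _
      simp
    · intro f _
      simp
  have h1 : (Fintype.card F : ℝ) * ∑ f ∈ monicsOfDegree F n, (quadraticChar F (f.coeff 0) : ℝ) =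
      0 := by
    calc _ = ∑ c : F, ∑ f ∈ monicsOfDegree F n, (quadraticChar F (f.coeff 0 + c) : ℝ) := by
          rw [← Finset.sum_congr rfl fun c _ => hshift c]
          simp
      _ = 0 := by
          rw [Finset.sum_comm]
          refine Finset.sum_eq_zero fun f _ => ?_
          refine (Fintype.sum_equiv (Equiv.addLeft (f.coeff 0)) _
            (fun a => (quadraticChar F a : ℝ)) fun c => rfl).trans ?_
          exact_mod_cast quadraticChar_sum_zero (ringChar_ne_two_of_odd_card hq)
  exact (mul_eq_zero.1 h1).resolve_left (by exact_mod_cast Fintype.card_ne_zero)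

open Classical in
lemma primeSeries_quadraticChar (hq : Odd (Fintype.card F)) :
    primeSeries (fun (P : F[X]) i => (quadraticChar F (P.coeff 0) : ℝ) ^ i) = 0 := by
  have h1 : genSeries (fun f : F[X] => (quadraticChar F (f.coeff 0) : ℝ)) = 1 := by
    ext n
    rw [PowerSeries.coeff_one, genSeries, PowerSeries.coeff_mk]
    split_ifs with h
    · subst h
      simp [monicsOfDegree_zero]
    · exact sum_quadraticChar_coeff_zero hq (Nat.pos_of_ne_zero h)
  refine HasLogDeriv.logDeriv_eq
    (f := genSeries fun f : F[X] => (quadraticChar F (f.coeff 0) : ℝ))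
    (hasLogDeriv_genSeries fun P _ _ g _ _ v => ?_) ?_ (h1 ▸ one_ne_zero)
  · have hc : ∀ i, (P ^ i * g).coeff 0 = P.coeff 0 ^ i * g.coeff 0 := by
      intro i
      simp only [coeff_zero_eq_eval_zero, eval_mul, eval_pow]
    simp only [hc, map_mul, map_pow]
    push_cast
    rw [Finset.sum_congr rfl (g := fun _ => (quadraticChar F (P.coeff 0) : ℝ) ^ v *
      (quadraticChar F (g.coeff 0) : ℝ))]
    · simp
    · intro i hi
      rw [Finset.mem_Icc] at hi
      rw [← mul_assoc, ← pow_add, Nat.add_sub_cancel' hi.2]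
  · rw [h1]
    simp [HasLogDeriv]

open Classical in
/-- The local weights of the logarithmic derivative of `∑_f X^{deg f}` over `f = A² + T B²`. -/
noncomputable def reprWeight (P : F[X]) (i : ℕ) : ℝ :=
  if IsSquare (P.coeff 0) then 1 else 1 + (-1) ^ i

open Classical in
/-- The local weights of the logarithmic derivative of
`(1 - X)⁻¹ ∏_P (1 - X^{2 deg P})⁻¹`, with `P` running over the inert primes. -/
noncomputable def inertWeight (P : F[X]) (i : ℕ) : ℝ :=
  if P.coeff 0 = 0 then 1 else if IsSquare (P.coeff 0) then 0 else 1 + (-1) ^ i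

lemma two_mul_primeSeries_reprWeight (hq : Odd (Fintype.card F)) :
    PowerSeries.C 2 * primeSeries (reprWeight (F := F)) =
      zetaLogDeriv (Fintype.card F) + primeSeries (inertWeight (F := F)) := by
  classical
  rw [← primeSeries_one, ← add_zero (primeSeries fun _ _ => 1), ← primeSeries_quadraticChar hq]
  ext j
  rw [PowerSeries.coeff_C_mul, map_add, map_add]
  simp only [primeSeries, PowerSeries.coeff_mk]
  rw [← Finset.sum_add_distrib, ← Finset.sum_add_distrib, Finset.mul_sum]
  refine Finset.sum_congr rfl fun P hP => ?_
  obtain ⟨-, h2, h3, h4⟩ := mem_primesOfDegreeDvd.1 hP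
  have hi : j / P.natDegree ≠ 0 :=
    (Nat.div_pos (Nat.le_of_dvd (Nat.pos_of_ne_zero h4) h3) h2.natDegree_pos).ne'
  set i := j / P.natDegree
  unfold reprWeight inertWeight
  by_cases h0 : P.coeff 0 = 0
  · simp [h0, hi]
    ring
  by_cases hs : IsSquare (P.coeff 0)
  · rw [(quadraticChar_one_iff_isSquare h0).2 hs]
    simp [h0, hs]
    ring
  · rw [quadraticChar_neg_one_iff_not_isSquare.2 hs]
    simp [h0, hs]
    ring

open Classical in
/-- The inert primes `P` with `2 deg P ∣ j`. -/
noncomputable def inertPrimes (F : Type*) [Field F] [Fintype F] (j : ℕ) : Finset F[X] :=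
  {P ∈ primesOfDegreeDvd F j | ¬ IsSquare (P.coeff 0) ∧ 2 * P.natDegree ∣ j}

lemma mem_inertPrimes {j : ℕ} {P : F[X]} :
    P ∈ inertPrimes F j ↔
      P.Monic ∧ Irreducible P ∧ ¬ IsSquare (P.coeff 0) ∧ 2 * P.natDegree ∣ j ∧ j ≠ 0 := by
  simp only [inertPrimes, Finset.mem_filter, mem_primesOfDegreeDvd]
  constructor
  · rintro ⟨⟨h1, h2, -, h4⟩, h5, h6⟩
    exact ⟨h1, h2, h5, h6, h4⟩
  · rintro ⟨h1, h2, h3, h4, h5⟩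
    exact ⟨⟨h1, h2, (dvd_mul_left _ _).trans h4, h5⟩, h3, h4⟩

lemma coeff_primeSeries_inertWeight {j : ℕ} (hj : j ≠ 0) :
    PowerSeries.coeff j (primeSeries (inertWeight (F := F))) =
      1 + ∑ P ∈ inertPrimes F j, ((2 * P.natDegree : ℕ) : ℝ) := by
  classical
  have hX : (X : F[X]) ∈ primesOfDegreeDvd F j := by
    simp [monic_X, irreducible_X, hj]
  rw [primeSeries, PowerSeries.coeff_mk, inertPrimes, Finset.sum_filter,
    ← Finset.sum_erase_add _ _ hX, ← Finset.sum_erase_add _ _ hX, add_comm (1 : ℝ)]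
  have h0 : IsSquare (0 : F) := IsSquare.zero
  simp only [natDegree_X, coeff_X_zero, h0, not_true, false_and, if_false, add_zero]
  congr 1
  · refine Finset.sum_congr rfl fun P hP => ?_
    obtain ⟨hPX, hP⟩ := Finset.mem_erase.1 hP
    obtain ⟨h1, h2, ⟨i, rfl⟩, h4⟩ := mem_primesOfDegreeDvd.1 hP
    have h5 : P.coeff 0 ≠ 0 := fun h => hPX (eq_of_monic_of_associated h1 monic_X
      (irreducible_X.associated_of_dvd h2 (X_dvd_iff.2 h)).symm)
    have h6 : 2 * P.natDegree ∣ P.natDegree * i ↔ Even i := by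
      rw [mul_comm 2, Nat.mul_dvd_mul_iff_left h2.natDegree_pos, ← even_iff_two_dvd]
    rw [Nat.mul_div_cancel_left _ h2.natDegree_pos]
    unfold inertWeight
    rw [if_neg h5]
    by_cases hs : IsSquare (P.coeff 0)
    · simp [hs]
    · rcases Nat.even_or_odd i with h | h
      · simp [hs, h6, h]
        ring
      · simp [hs, h6, h.neg_one_pow, Nat.not_even_iff_odd.2 h]
  · simp [inertWeight]

lemma coeff_primeSeries_inertWeight_nonneg (j : ℕ) :
    0 ≤ PowerSeries.coeff j (primeSeries (inertWeight (F := F))) := by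
  rcases eq_or_ne j 0 with rfl | hj
  · rw [coeff_zero_primeSeries]
  · rw [coeff_primeSeries_inertWeight hj]
    positivity

lemma coeff_primeSeries_inertWeight_le (j : ℕ) :
    PowerSeries.coeff j (primeSeries (inertWeight (F := F))) ≤
      4 * (Fintype.card F : ℝ) ^ (j / 2) := by
  rcases eq_or_ne j 0 with rfl | hj
  · rw [coeff_zero_primeSeries]
    positivity
  have hq : (1 : ℝ) ≤ (Fintype.card F : ℝ) ^ (j / 2) :=
    one_le_pow₀ (by exact_mod_cast Fintype.card_pos)
  rw [coeff_primeSeries_inertWeight hj]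
  rcases eq_or_ne (j / 2) 0 with h | h
  · have : inertPrimes F j = ∅ := by
      ext P
      simp only [mem_inertPrimes, Finset.notMem_empty, iff_false]
      rintro ⟨-, -, -, h4, -⟩
      have := (dvd_mul_right 2 _).trans h4
      omega
    rw [this, Finset.sum_empty]
    linarith
  · have h1 : ∑ P ∈ inertPrimes F j, ((2 * P.natDegree : ℕ) : ℝ) ≤
        ∑ P ∈ primesOfDegreeDvd F (j / 2), ((2 * P.natDegree : ℕ) : ℝ) := by
      refine Finset.sum_le_sum_of_subset_of_nonneg ?_ fun _ _ _ => by positivity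
      intro P hP
      obtain ⟨h1, h2, -, ⟨i, rfl⟩, -⟩ := mem_inertPrimes.1 hP
      refine mem_primesOfDegreeDvd.2 ⟨h1, h2, ⟨i, ?_⟩, h⟩
      rw [mul_assoc, Nat.mul_div_cancel_left _ two_pos]
    push_cast at h1 ⊢
    rw [← Finset.mul_sum (s := primesOfDegreeDvd F (j / 2)),
      sum_natDegree_primesOfDegreeDvd F h] at h1
    linarith

end PrimeSeries

/-! ### The correction factor -/

section Correction

lemma sum_antidiagonal_two_mul_snd_add_one (m : ℕ) :
    ∑ p ∈ Finset.HasAntidiagonal.antidiagonal m, 2 * ((p.2 : ℝ) + 1) = (m + 1) * (m + 2) := by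
  induction m with
  | zero => simp
  | succ m ih =>
    rw [Finset.Nat.sum_antidiagonal_succ, ih]
    push_cast
    ring

lemma HasLogDeriv.coeff_bounds {f L : PowerSeries ℝ} {q : ℝ} (hf : HasLogDeriv f L) (hq : 1 ≤ q)
    (h0 : PowerSeries.coeff 0 f = 1) (hL0 : PowerSeries.coeff 0 L = 0)
    (hL : ∀ j, 0 ≤ PowerSeries.coeff j L) (hLq : ∀ j, PowerSeries.coeff j L ≤ 2 * q ^ (j / 2))
    (k : ℕ) : 0 ≤ PowerSeries.coeff k f ∧ PowerSeries.coeff k f ≤ (k + 1) * q ^ (k / 2) := by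
  rw [hasLogDeriv_iff] at hf
  induction k using Nat.strong_induction_on with
  | _ k ih =>
    cases k with
    | zero => simp [h0]
    | succ m =>
      have hm := hf (m + 1)
      rw [Finset.Nat.sum_antidiagonal_succ, hL0, zero_mul, zero_add] at hm
      have hlt : ∀ p ∈ Finset.HasAntidiagonal.antidiagonal m, p.2 < m + 1 := fun p hp => by
        rw [Finset.HasAntidiagonal.mem_antidiagonal] at hp
        omega
      have hpos : (0 : ℝ) < ((m + 1 : ℕ) : ℝ) := by positivity
      constructor
      · refine nonneg_of_mul_nonneg_right (hm ▸ Finset.sum_nonneg fun p hp => ?_) hpos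
        exact mul_nonneg (hL _) (ih _ (hlt p hp)).1
      · refine le_of_mul_le_mul_left ?_ hpos
        rw [hm]
        calc _ ≤ ∑ p ∈ Finset.HasAntidiagonal.antidiagonal m,
              2 * ((p.2 : ℝ) + 1) * q ^ ((m + 1) / 2) := by
              refine Finset.sum_le_sum fun p hp => ?_
              have hp' := Finset.HasAntidiagonal.mem_antidiagonal.1 hp
              calc _ ≤ (2 * q ^ ((p.1 + 1) / 2)) * ((p.2 + 1) * q ^ (p.2 / 2)) :=
                    mul_le_mul (hLq _) (ih _ (hlt p hp)).2 (ih _ (hlt p hp)).1 (by positivity)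
                _ = 2 * ((p.2 : ℝ) + 1) * q ^ ((p.1 + 1) / 2 + p.2 / 2) := by
                    rw [pow_add]
                    ring
                _ ≤ _ := by
                    refine mul_le_mul_of_nonneg_left (pow_le_pow_right₀ hq ?_) (by positivity)
                    omega
          _ = _ := by
              rw [← Finset.sum_mul, sum_antidiagonal_two_mul_snd_add_one]
              push_cast
              ring

lemma pow_half_mul_inv_pow_le {q : ℝ} (hq : 3 ≤ q) {k : ℕ} (hk : 0 < k) :
    q ^ (k / 2) * q⁻¹ ^ k ≤ 3 * q⁻¹ * (3 / 5) ^ k := by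
  have hq0 : 0 < q := by linarith
  obtain ⟨m, hm⟩ : ∃ m, k = k / 2 + m + 1 := ⟨k - k / 2 - 1, by omega⟩
  have hkm : k ≤ 2 * (m + 1) := by omega
  calc q ^ (k / 2) * q⁻¹ ^ k = q⁻¹ * q⁻¹ ^ m := by
        conv_lhs => rw [hm]
        rw [show (k / 2 + m + 1) / 2 = k / 2 by omega]
        rw [pow_succ, pow_add, inv_pow]
        field_simp
    _ ≤ q⁻¹ * 3⁻¹ ^ m := by
        gcongr
    _ = 3 * q⁻¹ * 3⁻¹ ^ (m + 1) := by
        rw [pow_succ]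
        ring
    _ ≤ 3 * q⁻¹ * ((3 / 5) ^ 2) ^ (m + 1) := by
        gcongr
        norm_num
    _ ≤ 3 * q⁻¹ * (3 / 5) ^ k := by
        rw [← pow_mul]
        refine mul_le_mul_of_nonneg_left ?_ (by positivity)
        exact pow_le_pow_of_le_one (by norm_num) (by norm_num) hkm

open Polynomial

variable (F : Type*) [Field F] [Fintype F]

/-- The quotient of the generating series of the polynomials `A² + T B²` by
`(1 - q X)^{-1/2}`. -/
noncomputable def corrSeries : PowerSeries ℝ :=
  genSeries (reprIndicator (F := F)) * (halfZeta (Fintype.card F))⁻¹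

lemma constantCoeff_halfZeta (q : ℝ) : PowerSeries.constantCoeff (halfZeta q) = 1 := by
  rw [← PowerSeries.coeff_zero_eq_constantCoeff_apply]
  simp [halfZeta, halfBinom_zero]

lemma corrSeries_mul_halfZeta :
    corrSeries F * halfZeta (Fintype.card F) = genSeries (reprIndicator (F := F)) := by
  rw [corrSeries, mul_assoc, PowerSeries.inv_mul_cancel _ (by simp [constantCoeff_halfZeta]),
    mul_one]

lemma coeff_zero_corrSeries : PowerSeries.coeff 0 (corrSeries F) = 1 := by
  have h1 := congrArg (PowerSeries.coeff 0) (corrSeries_mul_halfZeta F)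
  have h2 : reprIndicator (1 : F[X]) = 1 := if_pos ⟨1, 0, by simp⟩
  rw [PowerSeries.coeff_zero_eq_constantCoeff_apply, map_mul, constantCoeff_halfZeta,
    mul_one] at h1
  rw [PowerSeries.coeff_zero_eq_constantCoeff_apply, h1]
  rw [genSeries, PowerSeries.coeff_mk, monicsOfDegree_zero, Finset.sum_singleton, h2]

variable {F}

lemma hasLogDeriv_corrSeries (hq : Odd (Fintype.card F)) :
    HasLogDeriv (corrSeries F) (PowerSeries.C (1 / 2) * primeSeries (inertWeight (F := F))) := by
  have h1 : HasLogDeriv (genSeries (reprIndicator (F := F)))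
      (primeSeries (reprWeight (F := F))) := by
    refine hasLogDeriv_genSeries fun P hP hi g _ hg v => ?_
    rw [reprIndicator_local hq hP hi hg]
    rfl
  rw [← corrSeries_mul_halfZeta F] at h1
  have h2 := h1.of_mul_right (hasLogDeriv_halfZeta _) fun h => by
    have := constantCoeff_halfZeta (Fintype.card F : ℝ)
    rw [h, map_zero] at this
    exact zero_ne_one this
  convert h2 using 1
  have h3 := two_mul_primeSeries_reprWeight hq
  have h4 : PowerSeries.C (1 / 2 : ℝ) * PowerSeries.C 2 = 1 := by
    rw [← map_mul]
    norm_num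
  linear_combination primeSeries (reprWeight (F := F)) * h4 - PowerSeries.C (1 / 2) * h3

variable (F) in
lemma three_le_card (hq : Odd (Fintype.card F)) : (3 : ℝ) ≤ Fintype.card F := by
  have h1 := Fintype.one_lt_card (α := F)
  obtain ⟨k, hk⟩ := hq
  exact_mod_cast (by omega : 3 ≤ Fintype.card F)

lemma coeff_corrSeries_bounds (hq : Odd (Fintype.card F)) (k : ℕ) :
    0 ≤ PowerSeries.coeff k (corrSeries F) ∧
      PowerSeries.coeff k (corrSeries F) ≤ (k + 1) * (Fintype.card F : ℝ) ^ (k / 2) := by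
  refine (hasLogDeriv_corrSeries hq).coeff_bounds (by linarith [three_le_card F hq])
    (coeff_zero_corrSeries F) ?_ (fun j => ?_) (fun j => ?_) k
  · rw [PowerSeries.coeff_C_mul, coeff_zero_primeSeries, mul_zero]
  · rw [PowerSeries.coeff_C_mul]
    exact mul_nonneg (by norm_num) (coeff_primeSeries_inertWeight_nonneg j)
  · rw [PowerSeries.coeff_C_mul]
    linarith [coeff_primeSeries_inertWeight_le (F := F) j]

variable (F) in
/-- The terms of the series `corrSeries` evaluated at `1 / q`. -/
noncomputable def corrTerm (k : ℕ) : ℝ :=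
  PowerSeries.coeff k (corrSeries F) * (Fintype.card F : ℝ)⁻¹ ^ k

lemma corrTerm_zero : corrTerm F 0 = 1 := by simp [corrTerm, coeff_zero_corrSeries]

lemma corrTerm_nonneg (hq : Odd (Fintype.card F)) (k : ℕ) : 0 ≤ corrTerm F k :=
  mul_nonneg (coeff_corrSeries_bounds hq k).1 (by positivity)

lemma corrTerm_le (hq : Odd (Fintype.card F)) {k : ℕ} (hk : 0 < k) :
    corrTerm F k ≤ (Fintype.card F : ℝ)⁻¹ * (3 * (k + 1) * (3 / 5) ^ k) := by
  calc corrTerm F k ≤ ((k + 1) * (Fintype.card F : ℝ) ^ (k / 2)) * (Fintype.card F : ℝ)⁻¹ ^ k :=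
        mul_le_mul_of_nonneg_right (coeff_corrSeries_bounds hq k).2 (by positivity)
    _ = (k + 1) * ((Fintype.card F : ℝ) ^ (k / 2) * (Fintype.card F : ℝ)⁻¹ ^ k) := by ring
    _ ≤ (k + 1) * (3 * (Fintype.card F : ℝ)⁻¹ * (3 / 5) ^ k) :=
        mul_le_mul_of_nonneg_left (pow_half_mul_inv_pow_le (three_le_card F hq) hk)
          (by positivity)
    _ = _ := by ring

lemma summable_pow_mul_three_fifths (m : ℕ) :
    Summable fun k : ℕ => (k : ℝ) ^ m * (3 / 5 : ℝ) ^ k :=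
  summable_pow_mul_geometric_of_norm_lt_one m
    (by rw [Real.norm_of_nonneg] <;> norm_num)

lemma summable_corrTerm (hq : Odd (Fintype.card F)) : Summable (corrTerm F) := by
  rw [← summable_nat_add_iff 1]
  refine Summable.of_nonneg_of_le (fun k => corrTerm_nonneg hq _)
    (fun k => corrTerm_le hq k.succ_pos) ?_
  have h : Summable fun k : ℕ =>
      (Fintype.card F : ℝ)⁻¹ * (3 * ((k : ℝ) + 1) * (3 / 5 : ℝ) ^ k) := by
    refine Summable.mul_left _ ?_
    convert ((summable_pow_mul_three_fifths 1).add
      (summable_pow_mul_three_fifths 0)).mul_left 3 using 2 with k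
    ring
  exact (summable_nat_add_iff 1).2 h

variable (F) in
/-- The value of `corrSeries` at `1 / q`. -/
noncomputable def corrValue : ℝ := ∑' k, corrTerm F k

lemma one_le_corrValue (hq : Odd (Fintype.card F)) : 1 ≤ corrValue F := by
  rw [← corrTerm_zero (F := F)]
  exact (summable_corrTerm hq).le_tsum 0 fun k _ => corrTerm_nonneg hq k

lemma hasSum_corrSeries_sq (hq : Odd (Fintype.card F)) :
    HasSum (fun n => PowerSeries.coeff n (corrSeries F * corrSeries F) *
      (Fintype.card F : ℝ)⁻¹ ^ n) (corrValue F ^ 2) := by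
  have h := (summable_corrTerm hq).norm
  have h1 := summable_norm_sum_mul_antidiagonal_of_summable_norm h h
  have h2 := tsum_mul_tsum_eq_tsum_sum_antidiagonal_of_summable_norm h h
  rw [pow_two, corrValue, h2]
  refine h1.of_norm.hasSum.congr_fun fun n => ?_
  rw [PowerSeries.coeff_mul, Finset.sum_mul]
  refine Finset.sum_congr rfl fun p hp => ?_
  rw [← Finset.HasAntidiagonal.mem_antidiagonal.1 hp, corrTerm, corrTerm, pow_add]
  ring

end Correction

/-! ### The Euler product -/

section EulerProduct

open Polynomial Filter Topology

lemma hasSum_mul_prod_one_sub_X_pow {ι : Type*} {f : PowerSeries ℝ} {x a : ℝ} (w : ι → ℕ)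
    (hf : HasSum (fun n => PowerSeries.coeff n f * x ^ n) a) (S : Finset ι) :
    HasSum (fun n => PowerSeries.coeff n (f * ∏ i ∈ S, (1 - PowerSeries.X ^ w i)) * x ^ n)
      (a * ∏ i ∈ S, (1 - x ^ w i)) := by
  classical
  induction S using Finset.induction_on with
  | empty => simpa using hf
  | insert i S hi ih =>
    have := hasSum_mul_one_sub_X_pow (w i) ih
    rw [mul_assoc, mul_assoc, mul_comm _ (1 - x ^ w i)] at this
    rw [Finset.prod_insert hi, Finset.prod_insert hi]
    rwa [mul_comm _ (1 - PowerSeries.X ^ w i)] at this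

lemma HasLogDeriv.mul_prod_one_sub_X_pow {ι : Type*} {f L : PowerSeries ℝ} {w : ι → ℕ}
    (hf : HasLogDeriv f L) (hw : ∀ i, 0 < w i) (S : Finset ι) :
    HasLogDeriv (f * ∏ i ∈ S, (1 - PowerSeries.X ^ w i)) (L - ∑ i ∈ S, geomLogDeriv (w i)) := by
  classical
  induction S using Finset.induction_on with
  | empty => simpa using hf
  | insert i S hi ih =>
    have := ih.mul (hasLogDeriv_one_sub_X_pow (hw i))
    rw [Finset.prod_insert hi, Finset.sum_insert hi]
    convert this using 1 <;> ring

/-- The monic irreducible polynomials with non-square constant coefficient. -/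
abbrev InertPrime (F : Type*) [Field F] : Type _ :=
  {P : F[X] // P.Monic ∧ Irreducible P ∧ ¬ IsSquare (P.coeff 0)}

variable {F : Type*} [Field F] [Fintype F]

/-- The square of `corrSeries`, with its pole at `1` and the factors of the primes in `S`
removed. -/
noncomputable def sievedSeries (S : Finset (InertPrime F)) : PowerSeries ℝ :=
  corrSeries F * corrSeries F * (1 - PowerSeries.X ^ 1) *
    ∏ P ∈ S, (1 - PowerSeries.X ^ (2 * P.1.natDegree))

lemma hasLogDeriv_corrSeries_sq (hq : Odd (Fintype.card F)) :
    HasLogDeriv (corrSeries F * corrSeries F) (primeSeries (inertWeight (F := F))) := by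
  convert (hasLogDeriv_corrSeries hq).mul (hasLogDeriv_corrSeries hq) using 1
  rw [← add_mul, ← map_add]
  norm_num

lemma hasLogDeriv_sievedSeries (hq : Odd (Fintype.card F)) (S : Finset (InertPrime F)) :
    HasLogDeriv (sievedSeries S) (primeSeries (inertWeight (F := F)) - geomLogDeriv 1 -
      ∑ P ∈ S, geomLogDeriv (2 * P.1.natDegree)) := by
  refine HasLogDeriv.mul_prod_one_sub_X_pow ?_ (fun P => ?_) S
  · rw [sub_eq_add_neg]
    exact (hasLogDeriv_corrSeries_sq hq).mul (hasLogDeriv_one_sub_X_pow one_pos)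
  · exact mul_pos two_pos P.2.2.1.natDegree_pos

lemma hasSum_sievedSeries (hq : Odd (Fintype.card F)) (S : Finset (InertPrime F)) :
    HasSum (fun n => PowerSeries.coeff n (sievedSeries S) * (Fintype.card F : ℝ)⁻¹ ^ n)
      (corrValue F ^ 2 * (1 - (Fintype.card F : ℝ)⁻¹) *
        ∏ P ∈ S, (1 - (Fintype.card F : ℝ)⁻¹ ^ (2 * P.1.natDegree))) := by
  refine hasSum_mul_prod_one_sub_X_pow _ ?_ S
  simpa using hasSum_mul_one_sub_X_pow 1 (hasSum_corrSeries_sq hq)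

lemma coeff_zero_sievedSeries (S : Finset (InertPrime F)) :
    PowerSeries.coeff 0 (sievedSeries S) = 1 := by
  have h := coeff_zero_corrSeries F
  rw [PowerSeries.coeff_zero_eq_constantCoeff_apply] at h ⊢
  simp only [sievedSeries, map_mul, h, map_sub, map_one, map_pow, PowerSeries.constantCoeff_X,
    map_prod]
  rw [Finset.prod_eq_one fun P _ => ?_]
  · norm_num
  · rw [zero_pow (mul_pos two_pos P.2.2.1.natDegree_pos).ne', sub_zero]

open Classical in
lemma coeff_logDeriv_sievedSeries (S : Finset (InertPrime F)) (j : ℕ) :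
    PowerSeries.coeff j (primeSeries (inertWeight (F := F)) - geomLogDeriv 1 -
      ∑ P ∈ S, geomLogDeriv (2 * P.1.natDegree)) =
      ∑ P ∈ inertPrimes F j \ S.map (Function.Embedding.subtype _),
        ((2 * P.natDegree : ℕ) : ℝ) := by
  have hsum : ∑ P ∈ S, PowerSeries.coeff j (geomLogDeriv (2 * P.1.natDegree)) =
      ∑ P ∈ inertPrimes F j ∩ S.map (Function.Embedding.subtype _),
        ((2 * P.natDegree : ℕ) : ℝ) := by
    refine (Finset.sum_map S (Function.Embedding.subtype _)
      (fun P => PowerSeries.coeff j (geomLogDeriv (2 * P.natDegree)))).symm.trans ?_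
    simp only [geomLogDeriv, PowerSeries.coeff_mk]
    rw [← Finset.sum_filter]
    refine Finset.sum_congr ?_ fun _ _ => rfl
    ext P
    simp only [Finset.mem_filter, Finset.mem_map, Function.Embedding.subtype_apply,
      Finset.mem_inter, mem_inertPrimes]
    constructor
    · rintro ⟨⟨P, hP, rfl⟩, h1, h2⟩
      exact ⟨⟨P.2.1, P.2.2.1, P.2.2.2, h2, h1.ne'⟩, P, hP, rfl⟩
    · rintro ⟨⟨-, -, -, h2, h1⟩, hP⟩
      exact ⟨hP, Nat.pos_of_ne_zero h1, h2⟩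
  rw [map_sub, map_sub, map_sum, hsum]
  rcases eq_or_ne j 0 with rfl | hj
  · have : inertPrimes F 0 = ∅ := by
      ext P
      simp [mem_inertPrimes]
    simp [this, coeff_zero_primeSeries, geomLogDeriv]
  · rw [coeff_primeSeries_inertWeight hj, ← Finset.sum_inter_add_sum_sdiff (inertPrimes F j)
      (S.map (Function.Embedding.subtype _))]
    simp [geomLogDeriv, Nat.pos_of_ne_zero hj]

lemma coeff_sievedSeries_bounds (hq : Odd (Fintype.card F)) (S : Finset (InertPrime F)) (n : ℕ) :
    0 ≤ PowerSeries.coeff n (sievedSeries S) ∧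
      PowerSeries.coeff n (sievedSeries S) ≤ PowerSeries.coeff n (corrSeries F * corrSeries F) := by
  classical
  have hn : ∀ j w, 0 ≤ PowerSeries.coeff j (geomLogDeriv w) := fun j w => by
    rw [geomLogDeriv, PowerSeries.coeff_mk]
    positivity
  refine (hasLogDeriv_sievedSeries hq S).coeff_le (hasLogDeriv_corrSeries_sq hq) (fun j => ?_)
    (fun j => ?_) (coeff_zero_primeSeries F _) ?_ ?_ n
  · rw [coeff_logDeriv_sievedSeries]
    positivity
  · rw [map_sub, map_sub, map_sum]
    have := hn j 1
    have := Finset.sum_nonneg fun P (_ : P ∈ S) => hn j (2 * P.1.natDegree)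
    linarith
  · rw [coeff_zero_sievedSeries]
    exact zero_le_one
  · have h := coeff_zero_corrSeries F
    rw [PowerSeries.coeff_zero_eq_constantCoeff_apply] at h
    rw [coeff_zero_sievedSeries, PowerSeries.coeff_zero_eq_constantCoeff_apply, map_mul, h]
    norm_num

lemma hasProd_one_sub_inv_pow (hq : Odd (Fintype.card F)) :
    HasProd (fun P : InertPrime F => 1 - (Fintype.card F : ℝ)⁻¹ ^ (2 * P.1.natDegree))
      (corrValue F ^ 2 * (1 - (Fintype.card F : ℝ)⁻¹))⁻¹ := by
  classical
  have hx : (Fintype.card F : ℝ)⁻¹ < 1 :=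
    inv_lt_one_of_one_lt₀ (by linarith [three_le_card F hq])
  set x := (Fintype.card F : ℝ)⁻¹ with hxdef
  have hx0 : 0 ≤ x := by positivity
  have hK := one_le_corrValue (F := F) hq
  have hA : 0 < corrValue F ^ 2 * (1 - x) := by
    have : 0 < 1 - x := by linarith
    positivity
  set A := corrValue F ^ 2 * (1 - x)
  have key : Tendsto (fun S : Finset (InertPrime F) =>
      A * ∏ P ∈ S, (1 - x ^ (2 * P.1.natDegree))) atTop (𝓝 1) := by
    rw [Metric.tendsto_nhds]
    intro ε hε
    have htail := (tendsto_sum_nat_add fun n =>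
      PowerSeries.coeff n (corrSeries F * corrSeries F) * x ^ n).eventually (gt_mem_nhds hε)
    obtain ⟨N, hN⟩ := ((tendsto_add_atTop_nat 1).eventually htail).exists
    filter_upwards [eventually_ge_atTop (((Finset.range (N + 1)).biUnion (inertPrimes F)).subtype
      fun P : F[X] => P.Monic ∧ Irreducible P ∧ ¬ IsSquare (P.coeff 0))] with S hS
    have hzero : ∀ n, 0 < n → n ≤ N → PowerSeries.coeff n (sievedSeries S) = 0 := by
      intro n hn hnN
      refine (hasLogDeriv_sievedSeries hq S).coeff_eq_zero (fun j hj => ?_) hn hnN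
      rw [coeff_logDeriv_sievedSeries, Finset.sdiff_eq_empty_iff_subset.2, Finset.sum_empty]
      intro P hP
      obtain ⟨h1, h2, h3, -⟩ := mem_inertPrimes.1 hP
      refine Finset.mem_map.2 ⟨⟨P, h1, h2, h3⟩, hS ?_, rfl⟩
      rw [Finset.mem_subtype, Finset.mem_biUnion]
      exact ⟨j, Finset.mem_range.2 (by omega), hP⟩
    have h1 := (hasSum_nat_add_iff' (N + 1)).2 (hasSum_sievedSeries hq S)
    rw [Finset.sum_eq_single_of_mem 0 (by simp) fun n hn hn0 => by
      rw [hzero n (Nat.pos_of_ne_zero hn0) (by simpa [Nat.lt_succ_iff] using hn), zero_mul],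
      coeff_zero_sievedSeries, pow_zero, mul_one] at h1
    have h2 := ((summable_nat_add_iff (N + 1)).2 (hasSum_corrSeries_sq hq).summable).hasSum
    have h3 := hasSum_le (fun n => mul_le_mul_of_nonneg_right
      (coeff_sievedSeries_bounds hq S (n + (N + 1))).2 (pow_nonneg hx0 _)) h1 h2
    have h4 := h1.nonneg fun n => mul_nonneg
      (coeff_sievedSeries_bounds hq S (n + (N + 1))).1 (pow_nonneg hx0 _)
    rw [Real.dist_eq, abs_of_nonneg h4]
    exact h3.trans_lt hN
  have h := key.const_mul A⁻¹
  simp only [inv_mul_cancel_left₀ hA.ne', mul_one] at h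
  exact h

lemma hasProd_rpow_eulerFactor (hq : Odd (Fintype.card F)) :
    HasProd (fun P : InertPrime F =>
      ((1 : ℝ) - (Fintype.card F : ℝ) ^ (-2 * (P.1.natDegree : ℤ))) ^ (-(1 : ℝ) / 2))
      (corrValue F * ((1 : ℝ) - (Fintype.card F : ℝ)⁻¹) ^ ((1 : ℝ) / 2)) := by
  have hx : (Fintype.card F : ℝ)⁻¹ < 1 :=
    inv_lt_one_of_one_lt₀ (by linarith [three_le_card F hq])
  have hK := one_le_corrValue (F := F) hq
  have hx0 : 0 < 1 - (Fintype.card F : ℝ)⁻¹ := by linarith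
  have hA : 0 < corrValue F ^ 2 * (1 - (Fintype.card F : ℝ)⁻¹) := by positivity
  have hval : (corrValue F ^ 2 * (1 - (Fintype.card F : ℝ)⁻¹))⁻¹ ^ (-(1 : ℝ) / 2) =
      corrValue F * ((1 : ℝ) - (Fintype.card F : ℝ)⁻¹) ^ ((1 : ℝ) / 2) := by
    rw [Real.inv_rpow hA.le, neg_div, Real.rpow_neg hA.le, inv_inv,
      Real.mul_rpow (by positivity) hx0.le, ← Real.sqrt_eq_rpow, Real.sqrt_sq (by linarith)]
  have h : Tendsto _ _ _ :=
    (hasProd_one_sub_inv_pow (F := F) hq).rpow_const (p := -(1 : ℝ) / 2)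
      (Or.inl (inv_pos.2 hA).ne')
  rw [hval] at h
  refine h.congr fun S => ?_
  rw [← Real.finsetProd_rpow]
  · refine Finset.prod_congr rfl fun P _ => ?_
    beta_reduce
    rw [neg_mul, zpow_neg, inv_pow]
    norm_cast
  · intro P _
    exact sub_nonneg.2 (pow_le_one₀ (by positivity) hx.le)

end EulerProduct

/-! ### The asymptotic formula -/

section Asymptotics

open Polynomial

variable {F : Type*} [Field F] [Fintype F]

lemma natCard_repr_eq_coeff (n : ℕ) :
    (Nat.card {f : F[X] // f.Monic ∧ f.natDegree = n ∧ ∃ A B : F[X], f = A ^ 2 + X * B ^ 2} : ℝ) =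
      PowerSeries.coeff n (genSeries (reprIndicator (F := F))) := by
  classical
  have h : ∀ f : F[X], f.Monic ∧ f.natDegree = n ∧ (∃ A B : F[X], f = A ^ 2 + X * B ^ 2) ↔
      f ∈ {f ∈ monicsOfDegree F n | IsRepr f} := fun f => by
    rw [Finset.mem_filter, mem_monicsOfDegree, and_assoc]
    rfl
  rw [Nat.card_congr (Equiv.subtypeEquivRight h), Nat.card_eq_fintype_card, Fintype.card_coe,
    genSeries, PowerSeries.coeff_mk, Finset.card_filter]
  push_cast
  rfl

lemma hasSum_corrTerm_mul_halfBinom (n : ℕ) :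
    HasSum (fun k => corrTerm F k * if k ≤ n then halfBinom (n - k) else 0)
      (PowerSeries.coeff n (genSeries (reprIndicator (F := F))) / (Fintype.card F : ℝ) ^ n) := by
  have hq : (Fintype.card F : ℝ) ≠ 0 := by exact_mod_cast Fintype.card_ne_zero
  convert hasSum_sum_of_ne_finset_zero (L := SummationFilter.unconditional ℕ)
    (s := Finset.range (n + 1)) (fun k hk => ?_) using 1
  · rw [← corrSeries_mul_halfZeta, PowerSeries.coeff_mul,
      Finset.Nat.sum_antidiagonal_eq_sum_range_succ_mk, Finset.sum_div]
    refine Finset.sum_congr rfl fun k hk => ?_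
    have hkn : k ≤ n := by simpa [Nat.lt_succ_iff] using hk
    obtain ⟨m, rfl⟩ := Nat.exists_eq_add_of_le hkn
    rw [if_pos hkn, Nat.add_sub_cancel_left, corrTerm, halfZeta, PowerSeries.coeff_mk, pow_add,
      inv_pow]
    field_simp
  · rw [if_neg (by simpa [Nat.lt_succ_iff] using hk), mul_zero]

/-- The implied constant. -/
noncomputable def errorConst : ℝ := ∑' k : ℕ, 3 * ((k : ℝ) + 1) * (3 / 5) ^ k * (k : ℝ) ^ 3

lemma hasSum_errorConst :
    HasSum (fun k : ℕ => 3 * ((k : ℝ) + 1) * (3 / 5) ^ k * (k : ℝ) ^ 3) errorConst := by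
  refine ((((summable_pow_mul_three_fifths 4).add
    (summable_pow_mul_three_fifths 3)).mul_left 3).congr fun k => ?_).hasSum
  ring

lemma abs_coeff_genSeries_sub_le (hq : Odd (Fintype.card F)) {n : ℕ} (hn : 0 < n) :
    |PowerSeries.coeff n (genSeries (reprIndicator (F := F))) -
        corrValue F * halfBinom n * (Fintype.card F : ℝ) ^ n| ≤
      errorConst * (Fintype.card F : ℝ) ^ (n - 1) / (n : ℝ) ^ ((3 : ℝ) / 2) := by
  have hq0 : (0 : ℝ) < Fintype.card F := by exact_mod_cast Fintype.card_pos
  set q := (Fintype.card F : ℝ)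
  have h1 := (hasSum_corrTerm_mul_halfBinom (F := F) n).sub
    ((summable_corrTerm hq).hasSum.mul_right (halfBinom n))
  have h2 := tsum_of_norm_bounded (hasSum_errorConst.mul_left (q⁻¹ / (n : ℝ) ^ ((3 : ℝ) / 2)))
    (f := fun k => (corrTerm F k * if k ≤ n then halfBinom (n - k) else 0) -
      corrTerm F k * halfBinom n) fun k => by
    rw [← mul_sub, norm_mul, Real.norm_of_nonneg (corrTerm_nonneg hq k), Real.norm_eq_abs]
    have h3 := abs_halfBinom_sub_le hn k
    rcases Nat.eq_zero_or_pos k with rfl | hk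
    · simp
    · calc _ ≤ q⁻¹ * (3 * (k + 1) * (3 / 5) ^ k) * ((k : ℝ) ^ 3 / (n : ℝ) ^ (3 / 2 : ℝ)) :=
            mul_le_mul (corrTerm_le hq hk) h3 (abs_nonneg _) (by positivity)
        _ = _ := by ring
  rw [h1.tsum_eq, Real.norm_eq_abs] at h2
  calc _ = |PowerSeries.coeff n (genSeries (reprIndicator (F := F))) / q ^ n -
          corrValue F * halfBinom n| * q ^ n := by
        rw [← abs_of_pos (pow_pos hq0 n), ← abs_mul, abs_of_pos (pow_pos hq0 n), sub_mul,
          div_mul_cancel₀ _ (pow_pos hq0 n).ne']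
    _ ≤ q⁻¹ / (n : ℝ) ^ ((3 : ℝ) / 2) * errorConst * q ^ n :=
        mul_le_mul_of_nonneg_right h2 (by positivity)
    _ = _ := by
        obtain ⟨m, rfl⟩ := Nat.exists_eq_succ_of_ne_zero hn.ne'
        rw [Nat.succ_sub_one, pow_succ]
        field_simp

end Asymptotics

/-- Landau's theorem over 𝔽_q[T] for `A² + T·B²`, uniformly in `q` and `n`:
there is an absolute constant `C` such that for every finite field `F` of odd cardinality
`q = card F` and every `n ≥ 1`,
`|B(n,q) − K_q · binom(n − 1/2, n) · qⁿ| ≤ C · q^{n−1}/n^{3/2}`, where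
`K_q = (1 − q⁻¹)^{-1/2} · ∏_P (1 − q^{−2 deg P})^{-1/2}`, the (convergent) product being over
monic irreducible `P` with non-square constant coefficient. -/
theorem landau_A2_plus_TB2 :
    ∃ C : ℝ, 0 < C ∧
      ∀ (F : Type) [Field F] [Fintype F], Odd (Fintype.card F) →
        Multipliable
          (fun P : {P : Polynomial F // P.Monic ∧ Irreducible P ∧ ¬ IsSquare (P.coeff 0)} =>
            ((1 : ℝ) - (Fintype.card F : ℝ) ^ (-2 * ((P : Polynomial F).natDegree : ℤ))) ^
              (-(1 : ℝ) / 2)) ∧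
        ∀ n : ℕ, 0 < n →
          |(Nat.card {f : Polynomial F // f.Monic ∧ f.natDegree = n ∧
                ∃ A B : Polynomial F, f = A ^ 2 + Polynomial.X * B ^ 2} : ℝ) -
              (((1 : ℝ) - (Fintype.card F : ℝ)⁻¹) ^ (-(1 : ℝ) / 2) *
                ∏' P : {P : Polynomial F // P.Monic ∧ Irreducible P ∧ ¬ IsSquare (P.coeff 0)},
                  ((1 : ℝ) - (Fintype.card F : ℝ) ^ (-2 * ((P : Polynomial F).natDegree : ℤ))) ^
                    (-(1 : ℝ) / 2)) *
                rbinom ((n : ℝ) - 1 / 2) n * (Fintype.card F : ℝ) ^ n| ≤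
            C * (Fintype.card F : ℝ) ^ (n - 1) / (n : ℝ) ^ ((3 : ℝ) / 2) := by
  refine ⟨errorConst + 1, ?_, fun F _ _ hq => ⟨(hasProd_rpow_eulerFactor hq).multipliable,
    fun n hn => ?_⟩⟩
  · have := hasSum_errorConst.nonneg fun k => by positivity
    linarith
  have hx : (Fintype.card F : ℝ)⁻¹ < 1 :=
    inv_lt_one_of_one_lt₀ (by linarith [three_le_card F hq])
  have hx0 : 0 < 1 - (Fintype.card F : ℝ)⁻¹ := by linarith
  have hval : ((1 : ℝ) - (Fintype.card F : ℝ)⁻¹) ^ (-(1 : ℝ) / 2) *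
      (corrValue F * ((1 : ℝ) - (Fintype.card F : ℝ)⁻¹) ^ ((1 : ℝ) / 2)) = corrValue F := by
    rw [mul_left_comm, ← Real.rpow_add hx0]
    norm_num
  rw [(hasProd_rpow_eulerFactor hq).tprod_eq, hval, natCard_repr_eq_coeff]
  refine (abs_coeff_genSeries_sub_le hq hn).trans ?_
  gcongr
  linarith
end

section
/- There are absolute constants C, C′ such that for every prime power q and every positive integer n, |B₁(2n,q) − C_{q,1} · binom(n−1/2, n) · q^{2n}| ≤ C · q^{2n−1} / n^{3/2}, and moreover |C_{q,1} − 1| ≤ C′/q. -/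
section FiniteFieldCounting

open Polynomial

variable (F : Type) [Field F]

/-- The monic irreducible polynomials of degree `d`. -/
def monicIrreducibles (d : ℕ) : Set F[X] :=
  {P | P.Monic ∧ Irreducible P ∧ P.natDegree = d}

/-- The monic polynomials `f` of degree `n` such that the multiplicity in `f` of every monic
irreducible polynomial `P` is divisible by `e (deg P)`. -/
def monicsWithMultiplicity (e : ℕ → ℕ) (n : ℕ) : Set F[X] :=
  {f | f.Monic ∧ f.natDegree = n ∧
    ∀ P : F[X], P.Monic → Irreducible P → e P.natDegree ∣ multiplicity P f}

variable {F}

lemma Polynomial.Monic.finiteMultiplicity_of_irreducible {P f : F[X]} (hP : Irreducible P)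
    (hf : f.Monic) : FiniteMultiplicity P f :=
  FiniteMultiplicity.of_not_isUnit hP.not_isUnit hf.ne_zero

lemma Polynomial.Monic.multiplicity_eq_ite {P Q : F[X]} (hP : P.Monic) (hQ : Q.Monic)
    (hPi : Irreducible P) (hQi : Irreducible Q) [Decidable (P = Q)] :
    multiplicity P Q = if P = Q then 1 else 0 := by
  split_ifs with h
  · subst h; exact multiplicity_self
  · rw [multiplicity_eq_zero]
    intro hd
    exact h (eq_of_monic_of_associated hP hQ ((hPi.dvd_irreducible_iff_associated hQi).1 hd))

lemma Polynomial.Monic.natDegree_eq_sum_multiplicity (T : Finset F[X])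
    (hT : ∀ P ∈ T, P.Monic ∧ Irreducible P) {f : F[X]} (hf : f.Monic)
    (hTf : ∀ P : F[X], P.Monic → Irreducible P → P ∣ f → P ∈ T) :
    f.natDegree = ∑ P ∈ T, multiplicity P f * P.natDegree := by
  classical
  induction hn : f.natDegree using Nat.strong_induction_on generalizing f with
  | _ n ih =>
    by_cases hu : IsUnit f
    · rw [hf.isUnit_iff] at hu
      subst hu
      rw [natDegree_one] at hn
      rw [← hn, eq_comm]
      refine Finset.sum_eq_zero fun P hP => ?_
      rw [multiplicity_of_one_right (hT P hP).2.not_isUnit, zero_mul]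
    · obtain ⟨Q, hQm, hQi, g, rfl⟩ := exists_monic_irreducible_factor f hu
      have hg : g.Monic := hQm.of_mul_monic_left hf
      have hdeg : (Q * g).natDegree = Q.natDegree + g.natDegree := hQm.natDegree_mul hg
      have hQ0 : 0 < Q.natDegree := hQi.natDegree_pos
      have key := ih g.natDegree (by omega) hg
        (fun P h1 h2 h3 => hTf P h1 h2 (h3.mul_left Q)) rfl
      have hQT : Q ∈ T := hTf Q hQm hQi (dvd_mul_right _ _)
      rw [← hn, hdeg, key]
      have : ∀ P ∈ T, multiplicity P (Q * g) * P.natDegree =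
          (if P = Q then Q.natDegree else 0) + multiplicity P g * P.natDegree := by
        intro P hP
        rw [multiplicity_mul (hT P hP).2.prime
          (hf.finiteMultiplicity_of_irreducible (hT P hP).2),
          (hT P hP).1.multiplicity_eq_ite hQm (hT P hP).2 hQi]
        split_ifs with h
        · subst h; ring
        · ring
      rw [Finset.sum_congr rfl this, Finset.sum_add_distrib, Finset.sum_ite_eq' T Q, if_pos hQT]

lemma mul_pow_mem_monicsWithMultiplicity_iff {e : ℕ → ℕ} {P g : F[X]} (hP : P.Monic)
    (hPi : Irreducible P) (hg : g.Monic) (k n : ℕ) :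
    P ^ (e P.natDegree * k) * g ∈
        monicsWithMultiplicity F e (e P.natDegree * k * P.natDegree + n) ↔
      g ∈ monicsWithMultiplicity F e n := by
  classical
  have hPk : (P ^ (e P.natDegree * k)).Monic := hP.pow _
  have hdeg : (P ^ (e P.natDegree * k) * g).natDegree =
      e P.natDegree * k * P.natDegree + g.natDegree := by
    rw [hPk.natDegree_mul hg, hP.natDegree_pow]
  simp only [monicsWithMultiplicity, Set.mem_ofPred_eq, hPk.mul hg, hg, hdeg, true_and,
    Nat.add_left_cancel_iff]
  refine and_congr_right fun _ => forall_congr' fun Q => forall_congr' fun hQ =>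
    forall_congr' fun hQi => ?_
  rw [multiplicity_mul hQi.prime ((hPk.mul hg).finiteMultiplicity_of_irreducible hQi),
    (hP.finiteMultiplicity_of_irreducible hQi).multiplicity_pow hQi.prime,
    hQ.multiplicity_eq_ite hP hQi hPi]
  split_ifs with h
  · subst h
    rw [mul_one]
    exact Nat.dvd_add_right (dvd_mul_right _ _)
  · simp

variable [Fintype F]

variable (F) in
lemma finite_setOf_natDegree_le (n : ℕ) : {f : F[X] | f.natDegree ≤ n}.Finite := by
  have : Finite (degreeLT F (n + 1)) := Finite.of_equiv _ (degreeLTEquiv F (n + 1)).symm.toEquiv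
  refine (Set.toFinite (degreeLT F (n + 1) : Set F[X])).subset fun f hf => ?_
  simp only [SetLike.mem_coe, mem_degreeLT]
  exact (degree_le_of_natDegree_le hf).trans_lt (by exact_mod_cast n.lt_succ_self)

lemma finite_monicsWithMultiplicity (e : ℕ → ℕ) (n : ℕ) :
    (monicsWithMultiplicity F e n).Finite :=
  (finite_setOf_natDegree_le F n).subset fun _ hf => hf.2.1.le

lemma finite_monicIrreducibles (n : ℕ) : (monicIrreducibles F n).Finite :=
  (finite_setOf_natDegree_le F n).subset fun _ hf => hf.2.2.le

lemma ncard_monicsWithMultiplicity_one (n : ℕ) :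
    (monicsWithMultiplicity F (fun _ => 1) n).ncard = Fintype.card F ^ n := by
  have h : monicsWithMultiplicity F (fun _ => 1) n = {f | f.Monic ∧ f.natDegree = n} := by
    ext f; simp [monicsWithMultiplicity]
  rw [h, ← Nat.card_coe_set_eq, Set.coe_ofPred, Nat.card_congr (monicEquivDegreeLT n),
    Nat.card_congr (degreeLTEquiv F n).toEquiv]
  simp

omit [Fintype F] in
lemma ncard_setOf_pow_dvd {e : ℕ → ℕ} {P : F[X]} (hP : P.Monic)
    (hPi : Irreducible P) (k m n : ℕ) (h : e P.natDegree * k * P.natDegree + m = n) :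
    {f ∈ monicsWithMultiplicity F e n | P ^ (e P.natDegree * k) ∣ f}.ncard =
      (monicsWithMultiplicity F e m).ncard := by
  subst h
  rw [← Set.ncard_image_of_injective (monicsWithMultiplicity F e m)
    (mul_right_injective₀ (hP.pow (e P.natDegree * k)).ne_zero)]
  congr 1
  ext f
  constructor
  · rintro ⟨hf, g, rfl⟩
    have hg := (hP.pow (e P.natDegree * k)).of_mul_monic_left hf.1
    exact ⟨g, (mul_pow_mem_monicsWithMultiplicity_iff hP hPi hg k m).1 hf, rfl⟩
  · rintro ⟨g, hg, rfl⟩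
    exact ⟨(mul_pow_mem_monicsWithMultiplicity_iff hP hPi hg.1 k m).2 hg, dvd_mul_right _ _⟩

omit [Fintype F] in
lemma setOf_pow_dvd_eq_empty {e : ℕ → ℕ} {P : F[X]} (hP : P.Monic) (k n : ℕ)
    (h : n < e P.natDegree * k * P.natDegree) :
    {f ∈ monicsWithMultiplicity F e n | P ^ (e P.natDegree * k) ∣ f} = ∅ := by
  ext f
  simp only [Set.mem_ofPred_eq, Set.mem_empty_iff_false, iff_false, not_and]
  intro hf hd
  have := natDegree_le_of_dvd hd hf.1.ne_zero
  rw [hP.natDegree_pow, hf.2.1] at this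
  omega

/-- Counting polynomials by their degree, written as the total degree of their factors. -/
lemma mul_ncard_monicsWithMultiplicity (e : ℕ → ℕ) (he : ∀ d, 0 < e d) (n : ℕ) :
    n * (monicsWithMultiplicity F e n).ncard =
      ∑ m ∈ Finset.Icc 1 n,
        (∑ d ∈ Finset.Icc 1 m with e d * d ∣ m, e d * d * (monicIrreducibles F d).ncard) *
          (monicsWithMultiplicity F e (n - m)).ncard := by
  classical
  set S := monicsWithMultiplicity F e with hS
  have hSfin : ∀ n, (S n).Finite := finite_monicsWithMultiplicity e
  set A := fun d => (finite_monicIrreducibles (F := F) d).toFinset with hA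
  have hmemA : ∀ d P, P ∈ A d ↔ P.Monic ∧ Irreducible P ∧ P.natDegree = d := by
    intro d P; simp [hA, monicIrreducibles]
  have hcardA : ∀ d, (monicIrreducibles F d).ncard = (A d).card := fun d =>
    Set.ncard_eq_toFinset_card _ _
  have hcardS : ∀ d, (S d).ncard = (hSfin d).toFinset.card := fun d =>
    Set.ncard_eq_toFinset_card _ _
  have hdisj : (↑(Finset.Icc 1 n) : Set ℕ).PairwiseDisjoint A := by
    intro a _ b _ hab
    refine Finset.disjoint_left.2 fun P ha hb => hab ?_
    rw [← ((hmemA _ _).1 ha).2.2, ((hmemA _ _).1 hb).2.2]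
  have hdegf : ∀ f ∈ (hSfin n).toFinset, n = ∑ d ∈ Finset.Icc 1 n, ∑ P ∈ A d,
      ∑ k ∈ Finset.Icc 1 n, if P ^ (e d * k) ∣ f then e d * d else 0 := by
    intro f hf
    rw [Set.Finite.mem_toFinset] at hf
    have h1 := hf.1.natDegree_eq_sum_multiplicity ((Finset.Icc 1 n).biUnion A) (by
      intro P hP
      obtain ⟨d, -, hd⟩ := Finset.mem_biUnion.1 hP
      exact ⟨((hmemA _ _).1 hd).1, ((hmemA _ _).1 hd).2.1⟩) (by
      intro P h1 h2 h3
      refine Finset.mem_biUnion.2 ⟨P.natDegree, ?_, (hmemA _ _).2 ⟨h1, h2, rfl⟩⟩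
      rw [Finset.mem_Icc, ← hf.2.1]
      exact ⟨h2.natDegree_pos, natDegree_le_of_dvd h3 hf.1.ne_zero⟩)
    rw [hf.2.1, Finset.sum_biUnion hdisj] at h1
    conv_lhs => rw [h1]
    refine Finset.sum_congr rfl fun d _ => Finset.sum_congr rfl fun P hP => ?_
    obtain ⟨hP1, hP2, rfl⟩ := (hmemA _ _).1 hP
    have hfin := hf.1.finiteMultiplicity_of_irreducible hP2
    obtain ⟨c, hc⟩ := hf.2.2 P hP1 hP2
    have hcn : c ≤ n := by
      have h3 : P ^ multiplicity P f ∣ f := pow_multiplicity_dvd P f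
      have h4 := natDegree_le_of_dvd h3 hf.1.ne_zero
      rw [hP1.natDegree_pow, hf.2.1, hc] at h4
      have := he P.natDegree
      have := hP2.natDegree_pos
      calc c = 1 * c * 1 := by ring
        _ ≤ e P.natDegree * c * P.natDegree := by gcongr <;> omega
        _ ≤ n := h4
    have hset : (Finset.Icc 1 n).filter (fun k => P ^ (e P.natDegree * k) ∣ f) =
        Finset.Icc 1 c := by
      ext k
      simp only [Finset.mem_filter, Finset.mem_Icc, hfin.pow_dvd_iff_le_multiplicity, hc,
        Nat.mul_le_mul_left_iff (he _)]
      omega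
    rw [← Finset.sum_filter, hset, Finset.sum_const, Nat.card_Icc, hc, smul_eq_mul]
    simp only [Nat.add_sub_cancel]
    ring
  calc n * (S n).ncard = ∑ f ∈ (hSfin n).toFinset, n := by
        rw [Finset.sum_const, hcardS, smul_eq_mul, mul_comm]
    _ = ∑ d ∈ Finset.Icc 1 n, ∑ P ∈ A d, ∑ k ∈ Finset.Icc 1 n, ∑ f ∈ (hSfin n).toFinset,
          if P ^ (e d * k) ∣ f then e d * d else 0 := by
        rw [Finset.sum_congr rfl hdegf, Finset.sum_comm]
        refine Finset.sum_congr rfl fun d _ => ?_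
        rw [Finset.sum_comm]
        exact Finset.sum_congr rfl fun P _ => Finset.sum_comm
    _ = ∑ d ∈ Finset.Icc 1 n, ∑ P ∈ A d, ∑ k ∈ Finset.Icc 1 n, ∑ m ∈ Finset.Icc 1 n,
          if m = e d * k * d then e d * d * (S (n - m)).ncard else 0 := by
        refine Finset.sum_congr rfl fun d hd => Finset.sum_congr rfl fun P hP =>
          Finset.sum_congr rfl fun k hk => ?_
        obtain ⟨hP1, hP2, rfl⟩ := (hmemA _ _).1 hP
        rw [Finset.mem_Icc] at hk hd
        have h1 : ∑ f ∈ (hSfin n).toFinset,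
            (if P ^ (e P.natDegree * k) ∣ f then e P.natDegree * P.natDegree else 0) =
            {f ∈ S n | P ^ (e P.natDegree * k) ∣ f}.ncard * (e P.natDegree * P.natDegree) := by
          rw [← Finset.sum_filter, Finset.sum_const, smul_eq_mul]
          congr 1
          rw [← Set.ncard_coe_finset]
          congr 1
          ext f; simp
        rw [h1, Finset.sum_ite_eq']
        have hpos : 0 < e P.natDegree * k * P.natDegree :=
          Nat.mul_pos (Nat.mul_pos (he _) (by omega)) (by omega)
        split_ifs with h
        · rw [Finset.mem_Icc] at h
          rw [ncard_setOf_pow_dvd hP1 hP2 k (n - e P.natDegree * k * P.natDegree) n (by omega),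
            mul_comm]
        · rw [Finset.mem_Icc] at h
          rw [setOf_pow_dvd_eq_empty hP1 k n (by omega)]
          simp
    _ = ∑ d ∈ Finset.Icc 1 n, ∑ m ∈ Finset.Icc 1 n,
          (A d).card * if e d * d ∣ m then e d * d * (S (n - m)).ncard else 0 := by
        refine Finset.sum_congr rfl fun d hd => ?_
        rw [Finset.sum_const, smul_eq_mul, ← Finset.mul_sum]
        congr 1
        rw [Finset.sum_comm]
        refine Finset.sum_congr rfl fun m hm => ?_
        rw [Finset.mem_Icc] at hd hm
        have hed : 0 < e d * d := Nat.mul_pos (he d) (by omega)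
        split_ifs with h
        · obtain ⟨k, hk⟩ := h
          have hk0 : 0 < k := Nat.pos_of_ne_zero fun h0 => by subst h0; omega
          have hkm : k ≤ m := hk ▸ Nat.le_mul_of_pos_left k hed
          rw [Finset.sum_eq_single_of_mem k (Finset.mem_Icc.2 ⟨hk0, hkm.trans hm.2⟩),
            if_pos (by rw [hk]; ring)]
          intro j _ hjk
          rw [if_neg]
          intro hj
          refine hjk (Nat.eq_of_mul_eq_mul_left hed ?_)
          rw [← hk, hj]; ring
        · refine Finset.sum_eq_zero fun k _ => if_neg fun hk => h ⟨k, ?_⟩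
          rw [hk]; ring
    _ = _ := by
        rw [Finset.sum_comm]
        refine Finset.sum_congr rfl fun m hm => ?_
        rw [Finset.mem_Icc] at hm
        rw [Finset.sum_mul, Finset.sum_filter]
        symm
        refine Finset.sum_subset_zero_on_sdiff (Finset.Icc_subset_Icc_right hm.2) ?_ ?_
        · intro d hd
          rw [Finset.mem_sdiff, Finset.mem_Icc, Finset.mem_Icc] at hd
          rw [if_neg, mul_zero]
          intro h
          have h1 := Nat.le_of_dvd (by omega) h
          have h2 := Nat.le_mul_of_pos_left d (he d)
          omega
        · intro d _
          rw [hcardA]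
          split_ifs
          · ring
          · simp

/-- Gauss's count of monic irreducible polynomials, in summatory form. -/
lemma sum_mul_ncard_monicIrreducibles (n : ℕ) (hn : 0 < n) :
    ∑ d ∈ Finset.Icc 1 n with d ∣ n, d * (monicIrreducibles F d).ncard = Fintype.card F ^ n := by
  induction n using Nat.strong_induction_on with
  | _ n ih =>
    have key := mul_ncard_monicsWithMultiplicity (F := F) (fun _ => 1) (fun _ => one_pos) n
    obtain ⟨k, rfl⟩ : ∃ k, n = k + 1 := ⟨n - 1, by omega⟩
    simp only [one_mul, ncard_monicsWithMultiplicity_one] at key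
    rw [Finset.sum_Icc_succ_top (by omega), Nat.sub_self, pow_zero, mul_one,
      Finset.sum_congr rfl (g := fun _ => Fintype.card F ^ (k + 1)), Finset.sum_const,
      Nat.card_Icc] at key
    · simp only [Nat.add_sub_cancel, smul_eq_mul, add_one_mul] at key
      omega
    · intro m hm
      rw [Finset.mem_Icc] at hm
      rw [ih m (by omega) (by omega), ← pow_add]
      congr 1; omega

variable (F) in
/-- The total degree of the monic irreducible polynomials of odd degree dividing `m`. -/
noncomputable def oddIrreducibleWeight (m : ℕ) : ℕ :=
  ∑ d ∈ Finset.Icc 1 m with Odd d ∧ d ∣ m, d * (monicIrreducibles F d).ncard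

lemma oddIrreducibleWeight_le (m : ℕ) (hm : 0 < m) :
    oddIrreducibleWeight F m ≤ Fintype.card F ^ m := by
  rw [← sum_mul_ncard_monicIrreducibles m hm]
  refine Finset.sum_le_sum_of_subset fun d hd => ?_
  simp only [Finset.mem_filter] at hd ⊢
  exact ⟨hd.1, hd.2.2⟩

/-- The multiplicity modulus for polynomials of the form `A² + B²`. -/
def oddSquareModulus (d : ℕ) : ℕ := if Odd d then 2 else 1

lemma oddSquareModulus_pos (d : ℕ) : 0 < oddSquareModulus d := by
  unfold oddSquareModulus; split_ifs <;> norm_num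

lemma even_oddSquareModulus_mul (d : ℕ) : Even (oddSquareModulus d * d) := by
  unfold oddSquareModulus
  split_ifs with h
  · exact even_two_mul d
  · simpa using h

lemma sum_oddSquareModulus_mul (m : ℕ) (hm : 0 < m) :
    ∑ d ∈ Finset.Icc 1 (2 * m) with oddSquareModulus d * d ∣ 2 * m,
        oddSquareModulus d * d * (monicIrreducibles F d).ncard =
      Fintype.card F ^ (2 * m) + oddIrreducibleWeight F m := by
  rw [← sum_mul_ncard_monicIrreducibles (2 * m) (by omega)]
  have h1 : oddIrreducibleWeight F m = ∑ d ∈ Finset.Icc 1 (2 * m),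
      if Odd d ∧ d ∣ m then d * (monicIrreducibles F d).ncard else 0 := by
    rw [oddIrreducibleWeight, Finset.sum_filter]
    refine Finset.sum_subset (Finset.Icc_subset_Icc_right (by omega)) fun d hd hd' => ?_
    rw [Finset.mem_Icc] at hd hd'
    rw [if_neg]
    rintro ⟨-, h⟩
    have := Nat.le_of_dvd hm h
    omega
  rw [h1, Finset.sum_filter, Finset.sum_filter, ← Finset.sum_add_distrib]
  refine Finset.sum_congr rfl fun d _ => ?_
  by_cases ho : Odd d
  · have h2 : d ∣ 2 * m ↔ d ∣ m :=
      (Nat.coprime_two_right.2 ho).dvd_mul_left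
    have h3 : 2 * d ∣ 2 * m ↔ d ∣ m := Nat.mul_dvd_mul_iff_left two_pos
    simp only [oddSquareModulus, ho, if_true, h2, h3, true_and]
    split_ifs <;> ring
  · simp [oddSquareModulus, ho]

lemma two_mul_mul_ncard_oddSquare (n : ℕ) :
    2 * n * (monicsWithMultiplicity F oddSquareModulus (2 * n)).ncard =
      ∑ m ∈ Finset.Icc 1 n, (Fintype.card F ^ (2 * m) + oddIrreducibleWeight F m) *
        (monicsWithMultiplicity F oddSquareModulus (2 * (n - m))).ncard := by
  rw [mul_ncard_monicsWithMultiplicity _ oddSquareModulus_pos]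
  symm
  refine Finset.sum_of_injOn (2 * ·) (fun a _ b _ h => by simpa using h) ?_ ?_ ?_
  · intro m hm
    simp only [Finset.coe_Icc, Set.mem_Icc] at hm ⊢
    omega
  · intro m hm hm'
    rw [Finset.sum_eq_zero, zero_mul]
    intro d hd
    exfalso
    rw [Finset.mem_filter] at hd
    obtain ⟨k, hk⟩ := (even_oddSquareModulus_mul d).two_dvd.trans hd.2
    refine hm' ⟨k, ?_, hk.symm⟩
    rw [Finset.mem_Icc] at hm
    simp only [Finset.coe_Icc, Set.mem_Icc]
    omega
  · intro m hm
    rw [Finset.mem_Icc] at hm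
    rw [sum_oddSquareModulus_mul m (by omega), Nat.mul_sub]

omit [Fintype F] in
lemma ncard_oddSquare_zero :
    (monicsWithMultiplicity F oddSquareModulus 0).ncard = 1 := by
  rw [Set.ncard_eq_one]
  refine ⟨1, ?_⟩
  ext f
  constructor
  · rintro ⟨hf, h0, -⟩
    exact hf.natDegree_eq_zero.1 h0
  · rintro rfl
    refine ⟨monic_one, natDegree_one, fun P _ hP => ?_⟩
    rw [multiplicity_of_one_right hP.not_isUnit]
    exact dvd_zero _

omit [Fintype F] in
lemma mem_monicsWithMultiplicity_oddSquareModulus {n : ℕ} {f : F[X]} :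
    f ∈ monicsWithMultiplicity F oddSquareModulus n ↔ f.Monic ∧ f.natDegree = n ∧
      ∀ P : F[X], P.Monic → Irreducible P → Odd P.natDegree →
        ∀ k : ℕ, P ^ (2 * k + 1) ∣ f → P ^ (2 * k + 2) ∣ f := by
  refine and_congr_right fun hf => and_congr_right fun _ => forall_congr' fun P =>
    forall_congr' fun _ => forall_congr' fun hPi => ?_
  simp only [(hf.finiteMultiplicity_of_irreducible hPi).pow_dvd_iff_le_multiplicity,
    oddSquareModulus]
  split_ifs with ho
  · simp only [ho, true_imp_iff]
    constructor
    · intro h k; omega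
    · intro h
      have := h (multiplicity P f / 2)
      omega
  · simp [ho]

end FiniteFieldCounting

section HalfIntegerBinomial

lemma rbinom_sub_half_eq (n : ℕ) :
    rbinom ((n : ℝ) - 1 / 2) n =
      (∏ i ∈ Finset.range n, ((i : ℝ) + 1 / 2)) / (Nat.factorial n : ℝ) := by
  rw [rbinom, ← Finset.prod_range_reflect]
  congr 1
  refine Finset.prod_congr rfl fun i hi => ?_
  rw [Finset.mem_range] at hi
  rw [Nat.sub_sub, Nat.cast_sub (by omega)]
  push_cast
  ring

lemma rbinom_sub_half_zero : rbinom ((0 : ℕ) - 1 / 2 : ℝ) 0 = 1 := by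
  simp [rbinom]

lemma rbinom_sub_half_succ (n : ℕ) :
    2 * ((n : ℝ) + 1) * rbinom (((n + 1 : ℕ) : ℝ) - 1 / 2) (n + 1) =
      (2 * n + 1) * rbinom ((n : ℝ) - 1 / 2) n := by
  rw [rbinom_sub_half_eq, rbinom_sub_half_eq, Finset.prod_range_succ, Nat.factorial_succ]
  have : (Nat.factorial n : ℝ) ≠ 0 := by positivity
  push_cast
  field_simp

lemma rbinom_sub_half_nonneg (n : ℕ) : 0 ≤ rbinom ((n : ℝ) - 1 / 2) n := by
  rw [rbinom_sub_half_eq]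
  positivity

lemma sum_range_rbinom_sub_half (n : ℕ) :
    ∑ m ∈ Finset.range n, rbinom ((m : ℝ) - 1 / 2) m =
      2 * n * rbinom ((n : ℝ) - 1 / 2) n := by
  induction n with
  | zero => simp
  | succ n ih =>
    rw [Finset.sum_range_succ, ih]
    have := rbinom_sub_half_succ n
    push_cast at this ⊢
    linarith

lemma rbinom_sub_half_sq_mul_le (n : ℕ) :
    rbinom ((n : ℝ) - 1 / 2) n ^ 2 * (2 * n + 1) ≤ 1 := by
  induction n with
  | zero => simp [rbinom]
  | succ n ih =>
    set b := rbinom (((n + 1 : ℕ) : ℝ) - 1 / 2) (n + 1) with hb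
    set a := rbinom ((n : ℝ) - 1 / 2) n with ha
    have h : 2 * ((n : ℝ) + 1) * b = (2 * n + 1) * a := rbinom_sub_half_succ n
    have hn : (0 : ℝ) ≤ n := n.cast_nonneg
    have h2 : (2 * ((n : ℝ) + 1)) ^ 2 * (b ^ 2 * (2 * (n + 1) + 1)) =
        (2 * n + 1) * (2 * n + 3) * (a ^ 2 * (2 * n + 1)) := by
      calc _ = (2 * ((n : ℝ) + 1) * b) ^ 2 * (2 * n + 3) := by ring
        _ = _ := by rw [h]; ring
    push_cast
    have h3 : (2 * (n : ℝ) + 1) * (2 * n + 3) * (a ^ 2 * (2 * n + 1)) ≤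
        (2 * n + 1) * (2 * n + 3) * 1 := by gcongr
    have h4 : (2 * ((n : ℝ) + 1)) ^ 2 * (b ^ 2 * (2 * (n + 1) + 1)) ≤
        (2 * ((n : ℝ) + 1)) ^ 2 * 1 := by
      rw [h2]; nlinarith
    exact le_of_mul_le_mul_left h4 (by positivity)

lemma rbinom_sub_half_le (n : ℕ) :
    rbinom ((n : ℝ) - 1 / 2) n ≤ 1 / √((n : ℝ) + 1) := by
  have hn : (0 : ℝ) ≤ n := n.cast_nonneg
  rw [le_div_iff₀ (by positivity)]
  refine (sq_le_one_iff_abs_le_one _).1 ?_ |> (le_abs_self _).trans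
  rw [mul_pow, Real.sq_sqrt (by positivity)]
  have := rbinom_sub_half_sq_mul_le n
  nlinarith [mul_nonneg hn (sq_nonneg (rbinom ((n : ℝ) - 1 / 2) n))]

lemma rbinom_sub_half_le_one (n : ℕ) : rbinom ((n : ℝ) - 1 / 2) n ≤ 1 := by
  refine (rbinom_sub_half_le n).trans ?_
  rw [div_le_one (by positivity), Real.one_le_sqrt]
  linarith [n.cast_nonneg (α := ℝ)]

lemma rpow_three_halves {x : ℝ} (hx : 0 < x) : x ^ ((3 : ℝ) / 2) = x * √x := by
  rw [Real.sqrt_eq_rpow, show (3 : ℝ) / 2 = 1 + 1 / 2 by norm_num, Real.rpow_add hx, Real.rpow_one]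

lemma rbinom_sub_half_sub_succ (n : ℕ) :
    rbinom ((n : ℝ) - 1 / 2) n - rbinom (((n + 1 : ℕ) : ℝ) - 1 / 2) (n + 1) ≤
      1 / ((n : ℝ) + 1) ^ ((3 : ℝ) / 2) := by
  have hn : (0 : ℝ) < n + 1 := by positivity
  have h1 := rbinom_sub_half_succ n
  have h2 := rbinom_sub_half_le n
  rw [rpow_three_halves hn, mul_comm _ √_, ← div_div, le_div_iff₀ hn]
  have h3 : (0 : ℝ) ≤ 1 / √((n : ℝ) + 1) := by positivity
  nlinarith

lemma rbinom_sub_half_sub_nonneg (n : ℕ) :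
    0 ≤ rbinom ((n : ℝ) - 1 / 2) n - rbinom (((n + 1 : ℕ) : ℝ) - 1 / 2) (n + 1) := by
  have h1 := rbinom_sub_half_succ n
  have h2 := rbinom_sub_half_nonneg n
  have hn : (0 : ℝ) < n + 1 := by positivity
  refine nonneg_of_mul_nonneg_right (a := 2 * ((n : ℝ) + 1)) ?_ (by positivity)
  nlinarith

lemma abs_rbinom_sub_half_sub_add_le (m k : ℕ) :
    |rbinom ((m : ℝ) - 1 / 2) m - rbinom (((m + k : ℕ) : ℝ) - 1 / 2) (m + k)| ≤
      k / ((m : ℝ) + 1) ^ ((3 : ℝ) / 2) := by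
  induction k with
  | zero => simp
  | succ k ih =>
    have h1 := rbinom_sub_half_sub_succ (m + k)
    have h2 := rbinom_sub_half_sub_nonneg (m + k)
    have h3 : 1 / (((m + k : ℕ) : ℝ) + 1) ^ ((3 : ℝ) / 2) ≤ 1 / ((m : ℝ) + 1) ^ ((3 : ℝ) / 2) := by
      gcongr
      omega
    calc _ ≤ _ := abs_sub_le _ (rbinom (((m + k : ℕ) : ℝ) - 1 / 2) (m + k)) _
      _ ≤ k / ((m : ℝ) + 1) ^ ((3 : ℝ) / 2) + 1 / ((m : ℝ) + 1) ^ ((3 : ℝ) / 2) := by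
          refine add_le_add ih ?_
          rw [← add_assoc, abs_of_nonneg h2]
          exact h1.trans h3
      _ = _ := by push_cast; ring

/-- Shifted half-integer binomials, extended by zero, vary slowly in the shift. -/
lemma abs_shifted_rbinom_sub_le (n j : ℕ) (hn : 0 < n) :
    |(if j ≤ n then rbinom (((n - j : ℕ) : ℝ) - 1 / 2) (n - j) else 0) -
        rbinom ((n : ℝ) - 1 / 2) n| ≤ (j : ℝ) ^ 3 / (n : ℝ) ^ ((3 : ℝ) / 2) := by
  have hn' : (0 : ℝ) < n := by exact_mod_cast hn
  have hpow : ∀ k : ℕ, (k : ℝ) ^ ((3 : ℝ) / 2) ≤ (k : ℝ) ^ 2 := by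
    intro k
    rcases Nat.eq_zero_or_pos k with rfl | hk
    · simp
    · have : (1 : ℝ) ≤ k := by exact_mod_cast hk
      rw [← Real.rpow_natCast]
      exact Real.rpow_le_rpow_of_exponent_le this (by norm_num)
  split_ifs with h
  · obtain ⟨m, rfl⟩ := Nat.exists_eq_add_of_le' h
    rw [Nat.add_sub_cancel]
    refine (abs_rbinom_sub_half_sub_add_le m j).trans ?_
    rw [div_le_div_iff₀ (by positivity) (by positivity)]
    rcases Nat.eq_zero_or_pos j with rfl | hj
    · simp
    have h1 : ((m + j : ℕ) : ℝ) ≤ j * (m + 1) := by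
      have : m + j ≤ j * (m + 1) := by nlinarith
      exact_mod_cast this
    calc (j : ℝ) * ((m + j : ℕ) : ℝ) ^ ((3 : ℝ) / 2)
        ≤ j * ((j : ℝ) * (m + 1)) ^ ((3 : ℝ) / 2) := by gcongr
      _ = j * ((j : ℝ) ^ ((3 : ℝ) / 2) * ((m : ℝ) + 1) ^ ((3 : ℝ) / 2)) := by
          rw [Real.mul_rpow (by positivity) (by positivity)]
      _ ≤ j * ((j : ℝ) ^ 2 * ((m : ℝ) + 1) ^ ((3 : ℝ) / 2)) := by gcongr; exact hpow j
      _ = _ := by ring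
  · rw [zero_sub, abs_neg, abs_of_nonneg (rbinom_sub_half_nonneg n)]
    refine (rbinom_sub_half_le_one n).trans ?_
    rw [one_le_div (by positivity)]
    refine (hpow n).trans ?_
    have h1 : (1 : ℝ) ≤ j := by exact_mod_cast (by omega : 1 ≤ j)
    have h2 : (n : ℝ) ≤ j := by exact_mod_cast (by omega : n ≤ j)
    calc (n : ℝ) ^ 2 ≤ (j : ℝ) ^ 2 := by gcongr
      _ ≤ (j : ℝ) ^ 3 := pow_le_pow_right₀ h1 (by norm_num)

end HalfIntegerBinomial

section PowerSeriesFactor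

open PowerSeries in
/-- Factor `(1 - Q t)^{-1/2}` out of the power series `∑ s n tⁿ` with logarithmic derivative
`∑ (Q^(n+1) + w (n+1)) tⁿ / 2`. -/
lemma exists_convolution_rbinom (Q : ℝ) (w s : ℕ → ℝ) (hs0 : s 0 = 1)
    (hs : ∀ n : ℕ, 2 * ((n : ℝ) + 1) * s (n + 1) =
      ∑ ij ∈ Finset.HasAntidiagonal.antidiagonal n, (Q ^ (ij.1 + 1) + w (ij.1 + 1)) * s ij.2) :
    ∃ g : ℕ → ℝ, g 0 = 1 ∧
      (∀ n : ℕ, 2 * ((n : ℝ) + 1) * g (n + 1) =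
        ∑ ij ∈ Finset.HasAntidiagonal.antidiagonal n, w (ij.1 + 1) * g ij.2) ∧
      ∀ n : ℕ, s n = ∑ ij ∈ Finset.HasAntidiagonal.antidiagonal n,
        g ij.1 * (rbinom ((ij.2 : ℝ) - 1 / 2) ij.2 * Q ^ ij.2) := by
  set S : ℝ⟦X⟧ := mk s
  set A : ℝ⟦X⟧ := mk fun n : ℕ => rbinom ((n : ℝ) - 1 / 2) n * Q ^ n with hA
  set U : ℝ⟦X⟧ := mk fun n => Q ^ (n + 1) / 2
  set V : ℝ⟦X⟧ := mk fun n => w (n + 1) / 2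
  have hA0 : constantCoeff A ≠ 0 := by
    rw [← coeff_zero_eq_constantCoeff_apply, coeff_mk, rbinom_sub_half_zero]
    simp
  have hS : d⁄dX ℝ S = S * (U + V) := by
    ext n
    rw [coeff_derivative, mul_comm S, coeff_mul]
    simp only [S, U, V, coeff_mk, map_add]
    refine mul_left_cancel₀ (two_ne_zero' ℝ) ?_
    rw [mul_left_comm, mul_comm (s (n + 1)), hs n, Finset.mul_sum]
    exact Finset.sum_congr rfl fun _ _ => by ring
  have hAU : d⁄dX ℝ A = A * U := by
    ext n
    rw [coeff_derivative, coeff_mul, Finset.Nat.sum_antidiagonal_eq_sum_range_succ_mk]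
    simp only [A, U, coeff_mk]
    have h : ∀ k ∈ Finset.range n.succ, rbinom ((k : ℝ) - 1 / 2) k * Q ^ k *
        (Q ^ (n - k + 1) / 2) = rbinom ((k : ℝ) - 1 / 2) k * (Q ^ (n + 1) / 2) := by
      intro k hk
      rw [Finset.mem_range] at hk
      rw [show n + 1 = k + (n - k + 1) by omega, pow_add]
      ring
    rw [Finset.sum_congr rfl h, ← Finset.sum_mul, sum_range_rbinom_sub_half]
    push_cast
    ring
  have hAne : A ≠ 0 := fun h => hA0 (by rw [h]; simp)
  obtain ⟨G, hGA⟩ : ∃ G, G * A = S :=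
    ⟨S * A⁻¹, by rw [mul_assoc, PowerSeries.inv_mul_cancel A hA0, mul_one]⟩
  have hG : d⁄dX ℝ G = V * G := by
    have h1 := congrArg (d⁄dX ℝ) hGA
    rw [Derivation.leibniz, hS, hAU, smul_eq_mul, smul_eq_mul, ← hGA] at h1
    refine mul_left_cancel₀ hAne ?_
    linear_combination h1
  refine ⟨fun n => coeff n G, ?_, fun n => ?_, fun n => ?_⟩
  · have := congrArg (coeff 0) hGA
    rw [coeff_mul, Finset.Nat.antidiagonal_zero, Finset.sum_singleton, coeff_mk, coeff_mk, hs0,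
      rbinom_sub_half_zero] at this
    simpa using this
  · have := congrArg (coeff n) hG
    rw [coeff_derivative, coeff_mul] at this
    rw [mul_assoc, mul_comm (_ + _)]
    simp only [V, coeff_mk] at this ⊢
    rw [this, Finset.mul_sum]
    exact Finset.sum_congr rfl fun _ _ => by ring
  · have := congrArg (coeff n) hGA
    rw [coeff_mul] at this
    simpa [A, S] using this.symm

end PowerSeriesFactor

section ExponentialFormula

variable {Q : ℝ} {w g : ℕ → ℝ}

lemma nonneg_and_le_pow_of_recurrence (hQ : 0 < Q) (hw : ∀ n, 0 ≤ w (n + 1))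
    (hwQ : ∀ n, w (n + 1) ≤ Q ^ (n + 1)) (hg0 : g 0 = 1)
    (hg : ∀ n : ℕ, 2 * ((n : ℝ) + 1) * g (n + 1) =
      ∑ ij ∈ Finset.HasAntidiagonal.antidiagonal n, w (ij.1 + 1) * g ij.2) (n : ℕ) :
    0 ≤ g n ∧ g n ≤ Q ^ n := by
  induction n using Nat.strong_induction_on with
  | _ n ih =>
    rcases n with _ | n
    · simp [hg0]
    have hpos : (0 : ℝ) < 2 * ((n : ℝ) + 1) := by positivity
    have hle : ∀ ij ∈ Finset.HasAntidiagonal.antidiagonal n, ij.2 < n + 1 := by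
      intro ij hij
      rw [Finset.HasAntidiagonal.mem_antidiagonal] at hij
      omega
    constructor
    · refine nonneg_of_mul_nonneg_right (a := 2 * ((n : ℝ) + 1)) ?_ hpos
      rw [hg]
      exact Finset.sum_nonneg fun ij hij => mul_nonneg (hw _) (ih _ (hle ij hij)).1
    · refine le_of_mul_le_mul_left (a := 2 * ((n : ℝ) + 1)) ?_ hpos
      rw [hg]
      calc _ ≤ ∑ ij ∈ Finset.HasAntidiagonal.antidiagonal n, Q ^ (n + 1) := by
            refine Finset.sum_le_sum fun ij hij => ?_
            rw [Finset.HasAntidiagonal.mem_antidiagonal] at hij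
            rw [← hij, add_right_comm, pow_add]
            exact mul_le_mul (hwQ _) (ih _ (by omega)).2 (ih _ (by omega)).1 (by positivity)
        _ = ((n : ℝ) + 1) * Q ^ (n + 1) := by simp
        _ ≤ _ := by
            have : (0 : ℝ) ≤ ((n : ℝ) + 1) * Q ^ (n + 1) := by positivity
            linarith

lemma summable_mul_pow_of_le_pow (hQ : 0 < Q) {b : ℕ → ℝ} (hb : ∀ n, |b n| ≤ Q ^ n) {x : ℝ}
    (hx : |x| < Q⁻¹) : Summable fun n => |b n * x ^ n| := by
  have h1 : Q * |x| < 1 := by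
    rwa [← lt_inv_mul_iff₀ hQ, mul_one]
  refine Summable.of_nonneg_of_le (fun _ => abs_nonneg _) (fun n => ?_)
    (summable_geometric_of_lt_one (by positivity) h1)
  rw [abs_mul, abs_pow, mul_pow]
  gcongr
  exact hb n

lemma hasDerivAt_tsum_mul_pow (hQ : 0 < Q) {b : ℕ → ℝ} (hb : ∀ n, |b n| ≤ Q ^ n) {x : ℝ}
    (hx : |x| < Q⁻¹) :
    HasDerivAt (fun y => ∑' n, b n * y ^ n) (∑' n : ℕ, ((n : ℝ) + 1) * b (n + 1) * x ^ n) x := by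
  obtain ⟨r, hxr, hrQ⟩ := exists_between hx
  have hr0 : 0 < r := (abs_nonneg x).trans_lt hxr
  have hQr : Q * r < 1 := by rwa [← lt_inv_mul_iff₀ hQ, mul_one]
  have hu : Summable fun n : ℕ => r⁻¹ * ((n : ℝ) ^ 1 * (Q * r) ^ n) := by
    have hnorm : ‖Q * r‖ < 1 := by rwa [Real.norm_of_nonneg (by positivity)]
    exact (summable_pow_mul_geometric_of_norm_lt_one (R := ℝ) 1 hnorm).mul_left r⁻¹
  have hbound : ∀ (n : ℕ) (y : ℝ), y ∈ Set.Ioo (-r) r →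
      ‖b n * (n * y ^ (n - 1))‖ ≤ r⁻¹ * ((n : ℝ) ^ 1 * (Q * r) ^ n) := by
    intro n y hy
    rcases n with _ | n
    · simp
    rw [Real.norm_eq_abs, abs_mul, abs_mul, abs_pow, Nat.abs_cast, Nat.add_sub_cancel]
    calc _ ≤ Q ^ (n + 1) * (((n + 1 : ℕ) : ℝ) * r ^ n) := by
          gcongr
          · exact hb _
          · exact (abs_lt.2 hy).le
      _ = _ := by
          rw [mul_pow, pow_succ r]
          field_simp
  have hd : ∀ (n : ℕ) (y : ℝ), y ∈ Set.Ioo (-r) r →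
      HasDerivAt (fun z => b n * z ^ n) (b n * (n * y ^ (n - 1))) y :=
    fun n y _ => (hasDerivAt_pow n y).const_mul (b n)
  have hxI : x ∈ Set.Ioo (-r) r := abs_lt.1 hxr
  have key := hasDerivAt_tsum_of_isPreconnected hu isOpen_Ioo isPreconnected_Ioo hd hbound hxI
    (summable_mul_pow_of_le_pow hQ hb hx).of_abs hxI
  have hs : Summable fun n : ℕ => b n * (n * x ^ (n - 1)) :=
    Summable.of_norm_bounded hu fun n => hbound n x hxI
  rw [hs.tsum_eq_zero_add] at key
  convert! key using 1
  simp only [Nat.cast_zero, zero_mul, mul_zero, zero_add, Nat.add_sub_cancel, Nat.cast_add,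
    Nat.cast_one]
  exact tsum_congr fun n => by ring

lemma summable_succ_mul_mul_pow (hQ : 0 < Q) {b : ℕ → ℝ}
    (hb : ∀ n : ℕ, |((n : ℝ) + 1) * b (n + 1)| ≤ Q ^ (n + 1)) {x : ℝ} (hx : |x| < Q⁻¹) : Summable fun n : ℕ => |((n : ℝ) + 1) * b (n + 1) * x ^ n| := by
  have := (summable_mul_pow_of_le_pow hQ (b := fun n => ((n : ℝ) + 1) * b (n + 1) / Q)
    (fun n => ?_) hx).mul_left Q
  · refine this.congr fun n => ?_
    rw [div_mul_eq_mul_div, abs_div, abs_of_pos hQ]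
    field_simp
  · rw [abs_div, abs_of_pos hQ, div_le_iff₀ hQ, ← pow_succ]
    exact hb n

/-- The solution of `G' = (∑ w (n+1) xⁿ / 2) G`, `G 0 = 1` is an exponential. -/
lemma tsum_mul_pow_eq_exp (hQ : 0 < Q) (hw : ∀ n, 0 ≤ w (n + 1))
    (hwQ : ∀ n, w (n + 1) ≤ Q ^ (n + 1)) (hg0 : g 0 = 1)
    (hg : ∀ n : ℕ, 2 * ((n : ℝ) + 1) * g (n + 1) =
      ∑ ij ∈ Finset.HasAntidiagonal.antidiagonal n, w (ij.1 + 1) * g ij.2)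
    {x : ℝ} (hx : |x| < Q⁻¹) :
    ∑' n, g n * x ^ n = Real.exp (∑' n : ℕ, w n / (2 * n) * x ^ n) := by
  have hgb := nonneg_and_le_pow_of_recurrence hQ hw hwQ hg0 hg
  have hgabs : ∀ n, |g n| ≤ Q ^ n := fun n => by rw [abs_of_nonneg (hgb n).1]; exact (hgb n).2
  set h : ℕ → ℝ := fun n => w n / (2 * n) with hh
  have hsucc : ∀ n : ℕ, ((n : ℝ) + 1) * h (n + 1) = w (n + 1) / 2 := by
    intro n
    simp only [hh]
    push_cast
    field_simp
  have hhb : ∀ n : ℕ, |((n : ℝ) + 1) * h (n + 1)| ≤ Q ^ (n + 1) := by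
    intro n
    have := hw n
    rw [hsucc, abs_of_nonneg (by positivity)]
    exact (half_le_self (hw n)).trans (hwQ n)
  have hhabs : ∀ n, |h n| ≤ Q ^ n := by
    rintro (_ | n)
    · simp [hh]
    refine le_trans ?_ (hhb n)
    rw [abs_mul]
    refine le_mul_of_one_le_left (abs_nonneg _) ?_
    rw [abs_of_pos (by positivity)]
    linarith [n.cast_nonneg (α := ℝ)]
  set G := fun y : ℝ => ∑' n, g n * y ^ n
  set H := fun y : ℝ => ∑' n : ℕ, h n * y ^ n
  have hGH : ∀ y, |y| < Q⁻¹ → ∑' n : ℕ, ((n : ℝ) + 1) * g (n + 1) * y ^ n =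
      (∑' n : ℕ, ((n : ℝ) + 1) * h (n + 1) * y ^ n) * G y := by
    intro y hy
    have h1 : Summable fun n : ℕ => ‖((n : ℝ) + 1) * h (n + 1) * y ^ n‖ :=
      summable_succ_mul_mul_pow hQ hhb hy
    have h2 : Summable fun n : ℕ => ‖g n * y ^ n‖ := summable_mul_pow_of_le_pow hQ hgabs hy
    rw [tsum_mul_tsum_eq_tsum_sum_antidiagonal_of_summable_norm h1 h2]
    refine tsum_congr fun n => ?_
    have h4 : ((n : ℝ) + 1) * g (n + 1) =
        (∑ ij ∈ Finset.HasAntidiagonal.antidiagonal n, w (ij.1 + 1) * g ij.2) / 2 := by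
      rw [← hg n]; ring
    rw [h4, Finset.sum_div, Finset.sum_mul]
    refine Finset.sum_congr rfl fun ij hij => ?_
    rw [Finset.HasAntidiagonal.mem_antidiagonal] at hij
    rw [hsucc, ← hij, pow_add]
    ring
  have hderiv : ∀ y ∈ Set.Ioo (-Q⁻¹) Q⁻¹,
      HasDerivAt (fun y => G y * Real.exp (-H y)) 0 y := by
    intro y hy
    have hy' : |y| < Q⁻¹ := abs_lt.2 hy
    have hG := hasDerivAt_tsum_mul_pow hQ hgabs hy'
    have hH := hasDerivAt_tsum_mul_pow hQ hhabs hy'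
    rw [hGH y hy'] at hG
    convert! hG.mul hH.neg.exp using 1
    ring
  have hconst := isOpen_Ioo.is_const_of_deriv_eq_zero isPreconnected_Ioo
    (fun y hy => (hderiv y hy).differentiableAt.differentiableWithinAt)
    (fun y hy => (hderiv y hy).deriv) (abs_lt.1 hx)
    (show (0 : ℝ) ∈ Set.Ioo (-Q⁻¹) Q⁻¹ from abs_lt.1 (by simpa using hQ))
  have hG0 : G 0 = 1 := by
    simp only [G]
    rw [tsum_eq_single 0 (fun n hn => by simp [hn])]
    simp [hg0]
  have hH0 : H 0 = 0 := by
    simp only [H]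
    rw [tsum_eq_single 0 (fun n hn => by simp [hn])]
    simp [hh]
  simp only [hG0, hH0, neg_zero, Real.exp_zero, mul_one, Real.exp_neg] at hconst
  rwa [← div_eq_mul_inv, div_eq_one_iff_eq (Real.exp_ne_zero _)] at hconst

end ExponentialFormula

section OddEulerProduct

open Polynomial

variable {F : Type} [Field F] [Fintype F]

lemma hasSum_ite_natDegree_dvd (n : ℕ) (c : ℝ) (hn : 0 < n) :
    HasSum (fun P : {P : F[X] // P.Monic ∧ Irreducible P ∧ Odd P.natDegree} =>
      if (P : F[X]).natDegree ∣ n then ((P : F[X]).natDegree : ℝ) * c else 0)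
      ((oddIrreducibleWeight F n : ℝ) * c) := by
  classical
  set A := fun d => (finite_monicIrreducibles (F := F) d).toFinset with hA
  have hmemA : ∀ d P, P ∈ A d ↔ P.Monic ∧ Irreducible P ∧ P.natDegree = d := by
    intro d P; simp [hA, monicIrreducibles]
  set D := (Finset.Icc 1 n).filter fun d => Odd d ∧ d ∣ n with hD
  have hdisj : (D : Set ℕ).PairwiseDisjoint A := by
    intro a _ b _ hab
    refine Finset.disjoint_left.2 fun P ha hb => hab ?_
    rw [← ((hmemA _ _).1 ha).2.2, ((hmemA _ _).1 hb).2.2]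
  set p := fun P : F[X] => P.Monic ∧ Irreducible P ∧ Odd P.natDegree
  set f := fun P : F[X] => if P.natDegree ∣ n then (P.natDegree : ℝ) * c else 0
  have hT : ∀ P ∈ D.biUnion A, p P := by
    intro P hP
    obtain ⟨d, hd, hPd⟩ := Finset.mem_biUnion.1 hP
    obtain ⟨h1, h2, rfl⟩ := (hmemA _ _).1 hPd
    exact ⟨h1, h2, (Finset.mem_filter.1 hd).2.1⟩
  have hsum : ∑ P ∈ (D.biUnion A).subtype p, f P = (oddIrreducibleWeight F n : ℝ) * c := by
    rw [Finset.sum_subtype_of_mem f hT, Finset.sum_biUnion hdisj, oddIrreducibleWeight,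
      Nat.cast_sum, Finset.sum_mul]
    refine Finset.sum_congr rfl fun d hd => ?_
    have h1 : ∀ P ∈ A d, f P = d * c := by
      intro P hP
      simp only [f, ((hmemA _ _).1 hP).2.2, if_pos (Finset.mem_filter.1 hd).2.2]
    rw [Finset.sum_congr rfl h1, Finset.sum_const, nsmul_eq_mul,
      Set.ncard_eq_toFinset_card _ (finite_monicIrreducibles d)]
    push_cast
    ring
  rw [← hsum]
  refine hasSum_sum_of_ne_finset_zero fun P hP => if_neg fun hd => hP ?_
  rw [Finset.mem_subtype, Finset.mem_biUnion]
  exact ⟨_, Finset.mem_filter.2 ⟨Finset.mem_Icc.2 ⟨P.2.2.1.natDegree_pos,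
    Nat.le_of_dvd hn hd⟩, P.2.2.2, hd⟩, (hmemA _ _).2 ⟨P.2.1, P.2.2.1, rfl⟩⟩

lemma hasSum_ite_dvd_neg_log {y : ℝ} (hy0 : 0 ≤ y) (hy1 : y < 1) {d : ℕ} (hd : 0 < d) :
    HasSum (fun n : ℕ => if d ∣ n then (d : ℝ) * (y ^ n / (2 * n)) else 0)
      (-Real.log (1 - y ^ d) / 2) := by
  have hyd : |y ^ d| < 1 := by
    rw [abs_of_nonneg (by positivity)]
    exact pow_lt_one₀ hy0 hy1 hd.ne'
  have h1 := (Real.hasSum_pow_div_log_of_abs_lt_one hyd).div_const 2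
  have hinj : Function.Injective fun k : ℕ => d * (k + 1) := by
    intro a b hab
    simpa [hd.ne'] using hab
  rw [← hinj.hasSum_iff]
  · convert! h1 using 1
    ext k
    have : (d : ℝ) ≠ 0 := by exact_mod_cast hd.ne'
    simp only [Function.comp_apply, dvd_mul_right, if_true, ← pow_mul]
    push_cast
    field_simp
  · intro n hn
    split_ifs with h
    · obtain ⟨k, rfl⟩ := h
      rcases k with _ | k
      · simp
      · exact absurd ⟨k, rfl⟩ hn
    · rfl

lemma hasSum_neg_log_one_sub_pow {y : ℝ} (hy0 : 0 ≤ y) (hy : y < (Fintype.card F : ℝ)⁻¹) :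
    HasSum (fun P : {P : F[X] // P.Monic ∧ Irreducible P ∧ Odd P.natDegree} =>
      -Real.log (1 - y ^ (P : F[X]).natDegree) / 2)
      (∑' n : ℕ, (oddIrreducibleWeight F n : ℝ) / (2 * n) * y ^ n) := by
  have hq1 : (1 : ℝ) < Fintype.card F := by exact_mod_cast Fintype.one_lt_card
  have hq0 : (0 : ℝ) < Fintype.card F := by linarith
  have hy1 : y < 1 := hy.trans (inv_lt_one_of_one_lt₀ hq1)
  set L : ℕ × {P : F[X] // P.Monic ∧ Irreducible P ∧ Odd P.natDegree} → ℝ := fun nP =>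
    if (nP.2 : F[X]).natDegree ∣ nP.1
      then ((nP.2 : F[X]).natDegree : ℝ) * (y ^ nP.1 / (2 * nP.1)) else 0 with hL
  have hL0 : 0 ≤ L := by
    intro nP
    simp only [hL, Pi.zero_apply]
    split_ifs <;> positivity
  have hrow : ∀ n, HasSum (fun P => L (n, P))
      ((oddIrreducibleWeight F n : ℝ) / (2 * n) * y ^ n) := by
    intro n
    rcases Nat.eq_zero_or_pos n with rfl | hn
    · simp [hL, hasSum_zero]
    · have h := hasSum_ite_natDegree_dvd (F := F) n (y ^ n / (2 * n)) hn
      convert! h using 1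
      ring
  have hsum : Summable fun n : ℕ => (oddIrreducibleWeight F n : ℝ) / (2 * n) * y ^ n := by
    refine (summable_mul_pow_of_le_pow hq0 (fun n => ?_)
      (by rwa [abs_of_nonneg hy0])).of_abs
    rw [abs_of_nonneg (by positivity)]
    rcases n with _ | n
    · simp
    · have h1 : (oddIrreducibleWeight F (n + 1) : ℝ) ≤ (Fintype.card F : ℝ) ^ (n + 1) := by
        exact_mod_cast oddIrreducibleWeight_le (F := F) (n + 1) n.succ_pos
      refine (div_le_self (by positivity) ?_).trans h1
      push_cast
      linarith [n.cast_nonneg (α := ℝ)]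
  have hLs : Summable L := by
    rw [summable_prod_of_nonneg hL0]
    exact ⟨fun n => (hrow n).summable, by simpa only [fun n => (hrow n).tsum_eq] using hsum⟩
  have hcol : ∀ P, HasSum (fun n => L (n, P)) (-Real.log (1 - y ^ (P : F[X]).natDegree) / 2) :=
    fun P => hasSum_ite_dvd_neg_log hy0 hy1 P.2.2.1.natDegree_pos
  have htot := hLs.hasSum
  rw [(htot.prod_fiberwise hrow).tsum_eq]
  exact ((Equiv.prodComm _ _).hasSum_iff.2 htot).prod_fiberwise hcol

lemma hasProd_oddEulerProduct :
    HasProd (fun P : {P : F[X] // P.Monic ∧ Irreducible P ∧ Odd P.natDegree} =>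
      ((1 : ℝ) - (Fintype.card F : ℝ) ^ (-2 * ((P : F[X]).natDegree : ℤ))) ^ (-(1 : ℝ) / 2))
      (Real.exp (∑' n : ℕ, (oddIrreducibleWeight F n : ℝ) / (2 * n) *
        ((Fintype.card F : ℝ) ^ 2)⁻¹ ^ n)) := by
  have hq1 : (1 : ℝ) < Fintype.card F := by exact_mod_cast Fintype.one_lt_card
  have hy : ((Fintype.card F : ℝ) ^ 2)⁻¹ < (Fintype.card F : ℝ)⁻¹ := by
    gcongr
    exact lt_self_pow₀ hq1 (by norm_num)
  convert! (hasSum_neg_log_one_sub_pow (F := F) (by positivity) hy).rexp using 1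
  ext P
  have h1 : ((Fintype.card F : ℝ) ^ 2)⁻¹ ^ (P : F[X]).natDegree < 1 :=
    pow_lt_one₀ (by positivity) (hy.trans (inv_lt_one_of_one_lt₀ hq1)) P.2.2.1.natDegree_pos.ne'
  have h2 : (Fintype.card F : ℝ) ^ (-2 * ((P : F[X]).natDegree : ℤ)) =
      ((Fintype.card F : ℝ) ^ 2)⁻¹ ^ (P : F[X]).natDegree := by
    rw [zpow_mul, zpow_natCast, zpow_neg]
    rfl
  rw [h2, Real.rpow_def_of_pos (by linarith), Function.comp_apply]
  congr 1
  ring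

end OddEulerProduct

section LandauEstimate

lemma abs_sum_convolution_rbinom_sub_le {q : ℝ} (hq : 2 ≤ q) {c : ℕ → ℝ}
    (hc : ∀ j, |c j| ≤ q⁻¹ ^ j) {n : ℕ} (hn : 0 < n) :
    |∑ ij ∈ Finset.HasAntidiagonal.antidiagonal n,
        c ij.1 * rbinom ((ij.2 : ℝ) - 1 / 2) ij.2 -
        (∑' j, c j) * rbinom ((n : ℝ) - 1 / 2) n| ≤
      q⁻¹ * ((2 * ∑' j : ℕ, (j : ℝ) ^ 3 * (1 / 2) ^ j) / (n : ℝ) ^ ((3 : ℝ) / 2)) := by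
  set a := rbinom ((n : ℝ) - 1 / 2) n
  set b : ℕ → ℝ := fun j =>
    if j ≤ n then rbinom (((n - j : ℕ) : ℝ) - 1 / 2) (n - j) else 0 with hb
  have hq0 : 0 < q := by linarith
  have hq1 : q⁻¹ ≤ 1 / 2 := by
    rw [one_div]
    gcongr
  have hcs : Summable c := Summable.of_norm_bounded
    (summable_geometric_of_lt_one (by positivity) (by linarith)) hc
  have hcb : HasSum (fun j => c j * b j) (∑ ij ∈ Finset.HasAntidiagonal.antidiagonal n,
      c ij.1 * rbinom ((ij.2 : ℝ) - 1 / 2) ij.2) := by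
    rw [Finset.Nat.sum_antidiagonal_eq_sum_range_succ_mk]
    have h1 : ∑ j ∈ Finset.range n.succ, c j * rbinom (((n - j : ℕ) : ℝ) - 1 / 2) (n - j) =
        ∑ j ∈ Finset.range n.succ, c j * b j := by
      refine Finset.sum_congr rfl fun j hj => ?_
      rw [Finset.mem_range] at hj
      simp only [hb]
      rw [if_pos (by omega)]
    rw [h1]
    refine hasSum_sum_of_ne_finset_zero fun j hj => ?_
    rw [Finset.mem_range] at hj
    simp only [hb]
    rw [if_neg (by omega), mul_zero]
  have hterm : ∀ j, ‖c j * b j - c j * a‖ ≤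
      q⁻¹ * (2 * ((j : ℝ) ^ 3 * (1 / 2) ^ j) / (n : ℝ) ^ ((3 : ℝ) / 2)) := by
    intro j
    rw [← mul_sub, Real.norm_eq_abs, abs_mul]
    have h1 := abs_shifted_rbinom_sub_le n j hn
    rcases j with _ | j
    · simp [hb, a]
    calc |c (j + 1)| * |b (j + 1) - a|
        ≤ q⁻¹ ^ (j + 1) * (((j + 1 : ℕ) : ℝ) ^ 3 / (n : ℝ) ^ ((3 : ℝ) / 2)) := by
          gcongr
          exact hc _
      _ ≤ (q⁻¹ * (1 / 2) ^ j) * (((j + 1 : ℕ) : ℝ) ^ 3 / (n : ℝ) ^ ((3 : ℝ) / 2)) := by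
          rw [pow_succ']
          gcongr
      _ = _ := by rw [pow_succ]; ring
  have hsum : Summable fun j : ℕ => (j : ℝ) ^ 3 * (1 / 2 : ℝ) ^ j :=
    summable_pow_mul_geometric_of_norm_lt_one 3 (by norm_num)
  have hbound : HasSum (fun j : ℕ => q⁻¹ * (2 * ((j : ℝ) ^ 3 * (1 / 2) ^ j) /
      (n : ℝ) ^ ((3 : ℝ) / 2)))
      (q⁻¹ * ((2 * ∑' j : ℕ, (j : ℝ) ^ 3 * (1 / 2) ^ j) / (n : ℝ) ^ ((3 : ℝ) / 2))) :=
    ((hsum.hasSum.mul_left 2).div_const _).mul_left _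
  have hdiff := hcb.sub (hcs.hasSum.mul_right a)
  rw [← hdiff.tsum_eq, ← hbound.tsum_eq]
  exact tsum_of_norm_bounded hbound.summable.hasSum hterm

lemma abs_tsum_sub_one_le {q : ℝ} (hq : 2 ≤ q) {c : ℕ → ℝ} (hc0 : c 0 = 1)
    (hc : ∀ j, |c j| ≤ q⁻¹ ^ j) : |∑' j, c j - 1| ≤ 2 / q := by
  have hq0 : 0 < q := by linarith
  have hq1 : q⁻¹ ≤ 1 / 2 := by
    rw [one_div]
    gcongr
  have hcs : Summable c := Summable.of_norm_bounded
    (summable_geometric_of_lt_one (by positivity) (by linarith)) hc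
  rw [hcs.tsum_eq_zero_add, hc0, add_sub_cancel_left]
  have h2 : HasSum (fun j : ℕ => q⁻¹ * (1 / 2 : ℝ) ^ j) (q⁻¹ * 2) :=
    hasSum_geometric_two.mul_left q⁻¹
  have h3 : 2 / q = q⁻¹ * 2 := by ring
  rw [h3]
  have h4 : ∀ j, ‖c (j + 1)‖ ≤ q⁻¹ * (1 / 2 : ℝ) ^ j := fun j =>
    (hc (j + 1)).trans (by rw [pow_succ']; gcongr)
  exact tsum_of_norm_bounded h2 h4

end LandauEstimate

open Polynomial in
lemma exists_oddSquare_convolution (F : Type) [Field F] [Fintype F] :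
    ∃ c : ℕ → ℝ, c 0 = 1 ∧ (∀ j, |c j| ≤ (Fintype.card F : ℝ)⁻¹ ^ j) ∧
      HasProd (fun P : {P : F[X] // P.Monic ∧ Irreducible P ∧ Odd P.natDegree} =>
        ((1 : ℝ) - (Fintype.card F : ℝ) ^ (-2 * ((P : F[X]).natDegree : ℤ))) ^ (-(1 : ℝ) / 2))
        (∑' j, c j) ∧
      ∀ n, ((monicsWithMultiplicity F oddSquareModulus (2 * n)).ncard : ℝ) =
        (∑ ij ∈ Finset.HasAntidiagonal.antidiagonal n,
          c ij.1 * rbinom ((ij.2 : ℝ) - 1 / 2) ij.2) * (Fintype.card F : ℝ) ^ (2 * n) := by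
  have hq1 : (1 : ℝ) < Fintype.card F := by exact_mod_cast Fintype.one_lt_card
  set q : ℝ := (Fintype.card F : ℝ) with hq
  have hq0 : 0 < q := by linarith
  set w : ℕ → ℝ := fun n => oddIrreducibleWeight F n
  have hw : ∀ n, 0 ≤ w (n + 1) := fun n => Nat.cast_nonneg _
  have hwq : ∀ n, w (n + 1) ≤ q ^ (n + 1) := fun n => by
    simp only [w, hq]
    exact_mod_cast oddIrreducibleWeight_le (F := F) (n + 1) n.succ_pos
  obtain ⟨g, hg0, hg, hsg⟩ := exists_convolution_rbinom (q ^ 2) w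
    (fun n => (monicsWithMultiplicity F oddSquareModulus (2 * n)).ncard)
    (by simp [ncard_oddSquare_zero]) (by
      intro n
      have key := congrArg (Nat.cast (R := ℝ)) (two_mul_mul_ncard_oddSquare (F := F) (n + 1))
      push_cast at key
      rw [key]
      refine Finset.sum_nbij' (fun m => (m - 1, n + 1 - m)) (fun ij => ij.1 + 1) ?_ ?_ ?_ ?_ ?_
      · intro m hm
        rw [Finset.mem_Icc] at hm
        rw [Finset.HasAntidiagonal.mem_antidiagonal]
        omega
      · intro ij hij
        rw [Finset.HasAntidiagonal.mem_antidiagonal] at hij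
        rw [Finset.mem_Icc]
        omega
      · intro m hm
        rw [Finset.mem_Icc] at hm
        exact Nat.sub_add_cancel hm.1
      · rintro ⟨i, j⟩ hij
        rw [Finset.HasAntidiagonal.mem_antidiagonal] at hij
        simp only [Prod.mk.injEq] at hij ⊢
        omega
      · intro m hm
        rw [Finset.mem_Icc] at hm
        simp only [Nat.sub_add_cancel hm.1, ← pow_mul, w, hq])
  have hgb := nonneg_and_le_pow_of_recurrence hq0 hw hwq hg0 hg
  have hy : ((q ^ 2)⁻¹ : ℝ) < q⁻¹ := by
    gcongr
    exact lt_self_pow₀ hq1 (by norm_num)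
  refine ⟨fun n => g n * (q ^ 2)⁻¹ ^ n, by simp [hg0], fun j => ?_, ?_, fun n => ?_⟩
  · rw [abs_of_nonneg (mul_nonneg (hgb j).1 (by positivity))]
    calc g j * (q ^ 2)⁻¹ ^ j ≤ q ^ j * (q ^ 2)⁻¹ ^ j := by
          gcongr
          exact (hgb j).2
      _ = _ := by
          rw [← mul_pow]
          congr 1
          field_simp
  · rw [tsum_mul_pow_eq_exp hq0 hw hwq hg0 hg (by rwa [abs_of_nonneg (by positivity)])]
    exact hasProd_oddEulerProduct
  · rw [hsg n, Finset.sum_mul]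
    refine Finset.sum_congr rfl fun ij hij => ?_
    rw [Finset.HasAntidiagonal.mem_antidiagonal] at hij
    simp only [← hij, pow_mul, pow_add, inv_pow]
    field_simp

/-- Landau's theorem over 𝔽_q[T] for `A² + B²`, uniformly in `q` and `n`:
`B₁(2n, q)` counts monic polynomials of degree `2n` in which every monic irreducible factor of
odd degree occurs with even multiplicity (encoded by: `P^{2k+1} ∣ f → P^{2k+2} ∣ f`).
Then `|B₁(2n,q) − C_{q,1} · binom(n − 1/2, n) · q^{2n}| ≤ C · q^{2n−1}/n^{3/2}` and
`|C_{q,1} − 1| ≤ C′/q` with absolute constants `C`, `C′`, where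
`C_{q,1} = ∏_P (1 − q^{−2 deg P})^{-1/2}`, the (convergent) product being over monic irreducible
`P` of odd degree. -/
theorem landau_A2_plus_B2 :
    ∃ C C' : ℝ, 0 < C ∧ 0 < C' ∧
      ∀ (F : Type) [Field F] [Fintype F],
        Multipliable
          (fun P : {P : Polynomial F // P.Monic ∧ Irreducible P ∧ Odd P.natDegree} =>
            ((1 : ℝ) - (Fintype.card F : ℝ) ^ (-2 * ((P : Polynomial F).natDegree : ℤ))) ^
              (-(1 : ℝ) / 2)) ∧
        (∀ n : ℕ, 0 < n →
          |(Nat.card {f : Polynomial F // f.Monic ∧ f.natDegree = 2 * n ∧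
                ∀ P : Polynomial F, P.Monic → Irreducible P → Odd P.natDegree →
                  ∀ k : ℕ, P ^ (2 * k + 1) ∣ f → P ^ (2 * k + 2) ∣ f} : ℝ) -
              (∏' P : {P : Polynomial F // P.Monic ∧ Irreducible P ∧ Odd P.natDegree},
                  ((1 : ℝ) - (Fintype.card F : ℝ) ^ (-2 * ((P : Polynomial F).natDegree : ℤ))) ^
                    (-(1 : ℝ) / 2)) *
                rbinom ((n : ℝ) - 1 / 2) n * (Fintype.card F : ℝ) ^ (2 * n)| ≤
            C * (Fintype.card F : ℝ) ^ (2 * n - 1) / (n : ℝ) ^ ((3 : ℝ) / 2)) ∧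
        |(∏' P : {P : Polynomial F // P.Monic ∧ Irreducible P ∧ Odd P.natDegree},
            ((1 : ℝ) - (Fintype.card F : ℝ) ^ (-2 * ((P : Polynomial F).natDegree : ℤ))) ^
              (-(1 : ℝ) / 2)) - 1| ≤ C' / (Fintype.card F : ℝ) := by
  have hconst : 0 ≤ ∑' j : ℕ, (j : ℝ) ^ 3 * (1 / 2 : ℝ) ^ j := tsum_nonneg fun j => by positivity
  refine ⟨2 * (∑' j : ℕ, (j : ℝ) ^ 3 * (1 / 2) ^ j) + 1, 2, by positivity, two_pos, ?_⟩
  intro F _ _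
  obtain ⟨c, hc0, hc, hprod, hcount⟩ := exists_oddSquare_convolution F
  have hq : (2 : ℝ) ≤ Fintype.card F := by exact_mod_cast Fintype.one_lt_card (α := F)
  rw [hprod.tprod_eq]
  refine ⟨hprod.multipliable, fun n hn => ?_, abs_tsum_sub_one_le hq hc0 hc⟩
  have hcard : Nat.card {f : Polynomial F // f.Monic ∧ f.natDegree = 2 * n ∧
      ∀ P : Polynomial F, P.Monic → Irreducible P → Odd P.natDegree →
        ∀ k : ℕ, P ^ (2 * k + 1) ∣ f → P ^ (2 * k + 2) ∣ f} =
      (monicsWithMultiplicity F oddSquareModulus (2 * n)).ncard := by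
    rw [← Nat.card_coe_set_eq]
    exact Nat.card_congr (Equiv.subtypeEquivRight fun f =>
      mem_monicsWithMultiplicity_oddSquareModulus.symm)
  have hpow : (Fintype.card F : ℝ) ^ (2 * n) =
      (Fintype.card F : ℝ) ^ (2 * n - 1) * Fintype.card F := by
    rw [← pow_succ]
    congr 1
    omega
  rw [hcard, hcount n, ← sub_mul, abs_mul, abs_of_nonneg (by positivity : (0 : ℝ) ≤
    (Fintype.card F : ℝ) ^ (2 * n))]
  calc _ ≤ _ := mul_le_mul_of_nonneg_right (abs_sum_convolution_rbinom_sub_le hq hc hn)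
        (by positivity)
    _ = (2 * ∑' j : ℕ, (j : ℝ) ^ 3 * (1 / 2) ^ j) * (Fintype.card F : ℝ) ^ (2 * n - 1) /
          (n : ℝ) ^ ((3 : ℝ) / 2) := by
        rw [hpow]
        field_simp
    _ ≤ _ := by
        gcongr
        linarith
end
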